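/- Let A → B be a homomorphism of strongly commutative DG R-algebras such that B is free as an underlying graded A-module, with diagonal ideal J. If N is a semifree DG B-module such that Ext^1_B(N, N ⊗_B J) = 0, then N is naively liftable to A. -/

import Mathlib

/-!
Common framework: strongly commutative non-negatively graded DG algebras over a
commutative ring `R`, right DG modules, semifree DG modules, Ext via the Hom complex,
homotopies, enveloping DG algebras, diagonal ideals, DG (quasi-)smoothness,
polynomial and free (divided power) extensions, and naive lifting.
-/

noncomputable section

/-- The Koszul sign `(-1)^i` for an integer `i`. -/
def ksign (i : ℤ) : ℤ := (((-1 : ℤˣ) ^ i : ℤˣ) : ℤ)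

/-- A strongly commutative, non-negatively graded differential graded algebra over a
commutative ring `R`: a graded `R`-algebra `A = ⊕_{n ≥ 0} A_n` with
`a * b = (-1)^{|a||b|} b * a`, `a^2 = 0` for `|a|` odd, and an `R`-linear degree `-1`
differential `d` with `d ∘ d = 0` satisfying the Leibniz rule. -/
structure DGAlgebra (R : Type) [CommRing R] where
  carrier : Type
  [ring : Ring carrier]
  [alg : Algebra R carrier]
  grading : ℤ → Submodule R carrier
  indep : ∀ i : ℤ, Disjoint (grading i) (⨆ j ≠ i, grading j)
  spanning : (⨆ i, grading i) = ⊤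
  nonneg : ∀ i : ℤ, i < 0 → grading i = ⊥
  one_mem : (1 : carrier) ∈ grading 0
  mul_mem : ∀ {i j : ℤ} {a b : carrier}, a ∈ grading i → b ∈ grading j →
    a * b ∈ grading (i + j)
  gcomm : ∀ {i j : ℤ} (a b : carrier), a ∈ grading i → b ∈ grading j →
    a * b = ksign (i * j) • (b * a)
  odd_sq : ∀ {i : ℤ} (a : carrier), Odd i → a ∈ grading i → a * a = 0
  d : carrier → carrier
  d_add : ∀ a b, d (a + b) = d a + d b
  d_rsmul : ∀ (r : R) a, d (r • a) = r • d a
  d_mem : ∀ {i : ℤ} {a : carrier}, a ∈ grading i → d a ∈ grading (i - 1)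
  d_sq : ∀ a, d (d a) = 0
  leibniz : ∀ {i : ℤ} (a b : carrier), a ∈ grading i →
    d (a * b) = d a * b + ksign i • (a * d b)

attribute [instance] DGAlgebra.ring DGAlgebra.alg

variable {R : Type} [CommRing R]

/-- A right DG module over a DG `R`-algebra `A`. -/
structure DGModule (R : Type) [CommRing R] (A : DGAlgebra R) where
  carrier : Type
  [acg : AddCommGroup carrier]
  [modR : Module R carrier]
  grading : ℤ → Submodule R carrier
  indep : ∀ i : ℤ, Disjoint (grading i) (⨆ j ≠ i, grading j)
  spanning : (⨆ i, grading i) = ⊤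
  smul : carrier → A.carrier → carrier
  smul_add : ∀ (m : carrier) (a b : A.carrier), smul m (a + b) = smul m a + smul m b
  add_smul : ∀ (m n : carrier) (a : A.carrier), smul (m + n) a = smul m a + smul n a
  smul_rsmul : ∀ (r : R) (m : carrier) (a : A.carrier), smul m (r • a) = r • smul m a
  rsmul_smul : ∀ (r : R) (m : carrier) (a : A.carrier), smul (r • m) a = r • smul m a
  smul_one : ∀ m : carrier, smul m 1 = m
  smul_mul : ∀ (m : carrier) (a b : A.carrier), smul (smul m a) b = smul m (a * b)
  smul_mem : ∀ {i j : ℤ} {m : carrier} {a : A.carrier},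
    m ∈ grading i → a ∈ A.grading j → smul m a ∈ grading (i + j)
  d : carrier → carrier
  d_add : ∀ x y, d (x + y) = d x + d y
  d_rsmul : ∀ (r : R) x, d (r • x) = r • d x
  d_mem : ∀ {i : ℤ} {m : carrier}, m ∈ grading i → d m ∈ grading (i - 1)
  d_sq : ∀ m, d (d m) = 0
  leibniz : ∀ {i : ℤ} (m : carrier) (a : A.carrier), m ∈ grading i →
    d (smul m a) = smul (d m) a + ksign i • smul m (A.d a)

attribute [instance] DGModule.acg DGModule.modR

/-- A graded `A`-linear map of degree `k` between DG `A`-modules (not necessarily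
compatible with the differentials). -/
structure GradedHom {A : DGAlgebra R} (M N : DGModule R A) (k : ℤ) where
  toFun : M.carrier → N.carrier
  map_add : ∀ x y, toFun (x + y) = toFun x + toFun y
  map_rsmul : ∀ (r : R) x, toFun (r • x) = r • toFun x
  map_smul : ∀ (x : M.carrier) (a : A.carrier), toFun (M.smul x a) = N.smul (toFun x) a
  map_mem : ∀ {i : ℤ} {x : M.carrier}, x ∈ M.grading i → toFun x ∈ N.grading (i + k)

/-- A homomorphism of DG `A`-modules: a degree `0` graded `A`-linear chain map. -/
structure DGHom {A : DGAlgebra R} (M N : DGModule R A) where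
  toFun : M.carrier → N.carrier
  map_add : ∀ x y, toFun (x + y) = toFun x + toFun y
  map_rsmul : ∀ (r : R) x, toFun (r • x) = r • toFun x
  map_smul : ∀ (x : M.carrier) (a : A.carrier), toFun (M.smul x a) = N.smul (toFun x) a
  map_mem : ∀ {i : ℤ} {x : M.carrier}, x ∈ M.grading i → toFun x ∈ N.grading i
  comm_d : ∀ x, toFun (M.d x) = N.d (toFun x)

/-- A degree `-k` element `f` of the Hom complex `Hom_A(N, M)` is a cocycle
(representing a class in `Ext^k_A(N,M) = H_{-k}(Hom_A(N,M))`). -/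
def IsExtCocycle {A : DGAlgebra R} {N M : DGModule R A} (k : ℤ)
    (f : GradedHom N M (-k)) : Prop :=
  ∀ x, M.d (f.toFun x) = ksign k • f.toFun (N.d x)

/-- A degree `-k` cocycle of the Hom complex is a coboundary. -/
def IsExtCoboundary {A : DGAlgebra R} {N M : DGModule R A} (k : ℤ)
    (f : GradedHom N M (-k)) : Prop :=
  ∃ h : GradedHom N M (-k + 1), ∀ x,
    f.toFun x = M.d (h.toFun x) + ksign k • h.toFun (N.d x)

/-- `Ext^k_A(N, M) = H_{-k}(Hom_A(N, M)) = 0`. -/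
def ExtVanish {A : DGAlgebra R} (k : ℤ) (N M : DGModule R A) : Prop :=
  ∀ f : GradedHom N M (-k), IsExtCocycle k f → IsExtCoboundary k f

/-- A DG module homomorphism `j : M' → M` induces an isomorphism
`Ext^k_A(N, M') ≅ Ext^k_A(N, M)`; stated at the level of cocycles and coboundaries
of the Hom complexes (injectivity and surjectivity of the induced map on `H_{-k}`). -/
def InducesExtIso {A : DGAlgebra R} (k : ℤ) (N : DGModule R A) {M' M : DGModule R A}
    (j : DGHom M' M) : Prop :=
  (∀ f : GradedHom N M' (-k), IsExtCocycle k f →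
    (∃ h : GradedHom N M (-k + 1), ∀ x,
      j.toFun (f.toFun x) = M.d (h.toFun x) + ksign k • h.toFun (N.d x)) →
    IsExtCoboundary k f) ∧
  (∀ g : GradedHom N M (-k), IsExtCocycle k g →
    ∃ f : GradedHom N M' (-k), IsExtCocycle k f ∧
      ∃ h : GradedHom N M (-k + 1), ∀ x,
        j.toFun (f.toFun x) - g.toFun x = M.d (h.toFun x) + ksign k • h.toFun (N.d x))

/-- Two maps of DG `A`-modules are homotopic: `f - g = ∂ ∘ h + h ∘ ∂` for a graded
`A`-linear map `h` of degree `1`. -/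
def DGHomotopic {A : DGAlgebra R} {M N : DGModule R A}
    (f g : M.carrier → N.carrier) : Prop :=
  ∃ h : GradedHom M N 1, ∀ x, f x - g x = N.d (h.toFun x) + h.toFun (M.d x)

/-- A DG module homomorphism `j : M' → M` induces a bijection
`Hom_{K(A)}(N, M') ≅ Hom_{K(A)}(N, M)` on homotopy classes of DG homomorphisms. -/
def InducesHtpyBij {A : DGAlgebra R} (N : DGModule R A) {M' M : DGModule R A}
    (j : DGHom M' M) : Prop :=
  (∀ f g : DGHom N M',
    DGHomotopic (fun x => j.toFun (f.toFun x)) (fun x => j.toFun (g.toFun x)) →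
    DGHomotopic f.toFun g.toFun) ∧
  (∀ g : DGHom N M, ∃ f : DGHom N M',
    DGHomotopic (fun x => j.toFun (f.toFun x)) g.toFun)

/-- A semifree basis of a DG `A`-module `N` on a family `e : κ → N`: a well-ordering
of `κ`, degrees making each `e k` homogeneous, such that `e` is a basis of the
underlying graded `A`-module and `∂(e k) ∈ Σ_{j < k} (e j)·A`. -/
structure SemifreeBasisOn {A : DGAlgebra R} (N : DGModule R A) {κ : Type}
    (e : κ → N.carrier) where
  lt : κ → κ → Prop
  wf : WellFounded lt
  trans : ∀ a b c, lt a b → lt b c → lt a c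
  trichotomous : ∀ a b, lt a b ∨ a = b ∨ lt b a
  deg : κ → ℤ
  homog : ∀ k, e k ∈ N.grading (deg k)
  basis : Function.Bijective
    (fun c : κ →₀ A.carrier => c.sum fun k a => N.smul (e k) a)
  d_lower : ∀ k, ∃ c : κ →₀ A.carrier, (∀ j ∈ c.support, lt j k) ∧
    N.d (e k) = c.sum fun j a => N.smul (e j) a

/-- A DG `A`-module is semifree if it admits a semifree basis. -/
def IsSemifree {A : DGAlgebra R} (N : DGModule R A) : Prop :=
  ∃ (κ : Type) (e : κ → N.carrier), Nonempty (SemifreeBasisOn N e)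

/-- A DG `A`-module has a finite semifree basis. -/
def HasFiniteSemifreeBasis {A : DGAlgebra R} (N : DGModule R A) : Prop :=
  ∃ (κ : Type) (e : κ → N.carrier), Finite κ ∧ Nonempty (SemifreeBasisOn N e)

/-- A DG module is bounded below: `N_i = 0` for `i ≪ 0`. -/
def BoundedBelow {A : DGAlgebra R} (N : DGModule R A) : Prop :=
  ∃ n₀ : ℤ, ∀ i : ℤ, i < n₀ → N.grading i = ⊥

/-- A homomorphism of DG `R`-algebras. -/
structure DGAlgHom (A B : DGAlgebra R) where
  toFun : A.carrier → B.carrier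
  map_one : toFun 1 = 1
  map_mul : ∀ x y, toFun (x * y) = toFun x * toFun y
  map_add : ∀ x y, toFun (x + y) = toFun x + toFun y
  map_rsmul : ∀ (r : R) x, toFun (r • x) = r • toFun x
  map_mem : ∀ {i : ℤ} {x : A.carrier}, x ∈ A.grading i → toFun x ∈ B.grading i
  comm_d : ∀ x, toFun (A.d x) = B.d (toFun x)

/-- A DG `A`-module homomorphism from a DG `A`-module `M` to (the restriction of
scalars along `φ : A → B` of) a DG `B`-module `W`. -/
structure ResHom {A B : DGAlgebra R} (φ : DGAlgHom A B) (M : DGModule R A)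
    (W : DGModule R B) where
  toFun : M.carrier → W.carrier
  map_add : ∀ x y, toFun (x + y) = toFun x + toFun y
  map_rsmul : ∀ (r : R) x, toFun (r • x) = r • toFun x
  map_mem : ∀ {i : ℤ} {x : M.carrier}, x ∈ M.grading i → toFun x ∈ W.grading i
  map_smul : ∀ (x : M.carrier) (a : A.carrier),
    toFun (M.smul x a) = W.smul (toFun x) (φ.toFun a)
  comm_d : ∀ x, toFun (M.d x) = W.d (toFun x)

/-- `T` is (up to isomorphism) the base change `M ⊗_A B` of the DG `A`-module `M`
along `φ : A → B`: universal property of the unit map `M → T`, `m ↦ m ⊗ 1`. -/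
structure DGBaseChange {A B : DGAlgebra R} (φ : DGAlgHom A B) (M : DGModule R A)
    (T : DGModule R B) where
  unit : ResHom φ M T
  univ : ∀ (W : DGModule R B) (f : ResHom φ M W),
    ∃ g : DGHom T W, (∀ x, g.toFun (unit.toFun x) = f.toFun x) ∧
      ∀ g' : DGHom T W, (∀ x, g'.toFun (unit.toFun x) = f.toFun x) →
        ∀ t, g'.toFun t = g.toFun t

/-- A DG `B`-module `W` is liftable to `A` along `φ : A → B` if `W ≅ M ⊗_A B`
for some DG `A`-module `M`. -/
def LiftableTo {A B : DGAlgebra R} (φ : DGAlgHom A B) (W : DGModule R B) : Prop :=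
  ∃ M : DGModule R A, Nonempty (DGBaseChange φ M W)

/-- An `A`-linear (via `φ : A → B`) chain map between the restrictions of two
DG `B`-modules. -/
structure ResHomB {A B : DGAlgebra R} (φ : DGAlgHom A B) (N W : DGModule R B) where
  toFun : N.carrier → W.carrier
  map_add : ∀ x y, toFun (x + y) = toFun x + toFun y
  map_rsmul : ∀ (r : R) x, toFun (r • x) = r • toFun x
  map_mem : ∀ {i : ℤ} {x : N.carrier}, x ∈ N.grading i → toFun x ∈ W.grading i
  map_smul : ∀ (x : N.carrier) (a : A.carrier),
    toFun (N.smul x (φ.toFun a)) = W.smul (toFun x) (φ.toFun a)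
  comm_d : ∀ x, toFun (N.d x) = W.d (toFun x)

/-- `T` is (up to isomorphism) the induced DG `B`-module `N|_A ⊗_A B` of a
DG `B`-module `N` along `φ : A → B`, with unit map `n ↦ n ⊗ 1`. -/
structure InducedModuleSpec {A B : DGAlgebra R} (φ : DGAlgHom A B)
    (N T : DGModule R B) where
  unit : ResHomB φ N T
  univ : ∀ (W : DGModule R B) (f : ResHomB φ N W),
    ∃ g : DGHom T W, (∀ x, g.toFun (unit.toFun x) = f.toFun x) ∧
      ∀ g' : DGHom T W, (∀ x, g'.toFun (unit.toFun x) = f.toFun x) →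
        ∀ t, g'.toFun t = g.toFun t

/-- `N` is naively liftable to `A` along `φ : A → B`: the canonical DG `B`-module
epimorphism `π_N : N|_A ⊗_A B → N`, `n ⊗ b ↦ nb` (characterized as the unique
DG `B`-map splitting the unit) admits a right inverse DG `B`-module homomorphism. -/
def NaivelyLiftable {A B : DGAlgebra R} (φ : DGAlgHom A B) (N : DGModule R B) : Prop :=
  ∀ (T : DGModule R B) (h : InducedModuleSpec φ N T) (πN : DGHom T N),
    (∀ x, πN.toFun (h.unit.toFun x) = x) →
    ∃ ρ : DGHom N T, ∀ y, πN.toFun (ρ.toFun y) = y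

/-- `N` is a direct summand of `W` as DG modules. -/
def IsDGDirectSummandOf {A : DGAlgebra R} (N W : DGModule R A) : Prop :=
  ∃ (ρ : DGHom N W) (p : DGHom W N), ∀ x, p.toFun (ρ.toFun x) = x

/-- `N` is a direct summand of some DG `B`-module which is liftable to `A`. -/
def DirectSummandOfLiftable {A B : DGAlgebra R} (φ : DGAlgHom A B)
    (N : DGModule R B) : Prop :=
  ∃ W : DGModule R B, LiftableTo φ W ∧ IsDGDirectSummandOf N W

/-- `B` is free as an underlying graded `A`-module (via `φ : A → B`), with a basis
of homogeneous elements. -/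
def FreeOverBase {A B : DGAlgebra R} (φ : DGAlgHom A B) : Prop :=
  ∃ (κ : Type) (e : κ → B.carrier) (dg : κ → ℤ),
    (∀ k, e k ∈ B.grading (dg k)) ∧
    Function.Bijective (fun c : κ →₀ A.carrier => c.sum fun k a => e k * φ.toFun a)

/-- `E` is (up to isomorphism) the enveloping DG algebra `B^e = B^o ⊗_A B` of
`φ : A → B`: it receives the two canonical maps `l : B° → E`, `b ↦ b^o ⊗ 1` and
`r : B → E`, `b ↦ 1^o ⊗ b` agreeing on `A`, and is universal (as a pushout of
strongly commutative DG algebras) with this property. -/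
structure EnvelopingAlg {A B : DGAlgebra R} (φ : DGAlgHom A B) (E : DGAlgebra R) where
  l : DGAlgHom B E
  r : DGAlgHom B E
  compat : ∀ a, l.toFun (φ.toFun a) = r.toFun (φ.toFun a)
  univ : ∀ (C : DGAlgebra R) (f g : DGAlgHom B C),
    (∀ a, f.toFun (φ.toFun a) = g.toFun (φ.toFun a)) →
    ∃ h : DGAlgHom E C, (∀ b, h.toFun (l.toFun b) = f.toFun b) ∧
      (∀ b, h.toFun (r.toFun b) = g.toFun b) ∧
      ∀ h' : DGAlgHom E C,
        ((∀ b, h'.toFun (l.toFun b) = f.toFun b) ∧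
          (∀ b, h'.toFun (r.toFun b) = g.toFun b)) → ∀ x, h'.toFun x = h.toFun x

/-- The diagonal ideal `J = ker(π_B : B^e → B)`. -/
def diagIdeal {A B E : DGAlgebra R} {φ : DGAlgHom A B} (_ : EnvelopingAlg φ E)
    (πB : DGAlgHom E B) : Set E.carrier :=
  {x | πB.toFun x = 0}

/-- A balanced pairing `N × S → W` realizing (maps out of) `N ⊗_B (S/Z)`, where
`S ⊆ B^e` is a DG `(B,B)`-sub-bimodule of `B^e` (left `B`-action via `l`, right
`B`-action via `r`) and `Z ⊆ S` is killed. -/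
structure TensorPairing {A B E : DGAlgebra R} (φ : DGAlgHom A B)
    (he : EnvelopingAlg φ E) (S Z : Set E.carrier) (N W : DGModule R B) where
  pair : N.carrier → E.carrier → W.carrier
  add_left : ∀ n n' x, x ∈ S → pair (n + n') x = pair n x + pair n' x
  add_right : ∀ n x y, x ∈ S → y ∈ S → pair n (x + y) = pair n x + pair n y
  rsmul_left : ∀ (r : R) n x, x ∈ S → pair (r • n) x = r • pair n x
  rsmul_right : ∀ (r : R) n x, x ∈ S → pair n (r • x) = r • pair n x
  balanced : ∀ (n : N.carrier) (b : B.carrier) (x : E.carrier), x ∈ S →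
    pair (N.smul n b) x = pair n (he.l.toFun b * x)
  act_right : ∀ (n : N.carrier) (b : B.carrier) (x : E.carrier), x ∈ S →
    pair n (x * he.r.toFun b) = W.smul (pair n x) b
  grade : ∀ {i j : ℤ} (n : N.carrier) (x : E.carrier),
    n ∈ N.grading i → x ∈ S → x ∈ E.grading j → pair n x ∈ W.grading (i + j)
  chain : ∀ {i : ℤ} (n : N.carrier) (x : E.carrier), n ∈ N.grading i → x ∈ S →
    W.d (pair n x) = pair (N.d n) x + ksign i • pair n (E.d x)
  kill : ∀ n x, x ∈ Z → pair n x = 0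

/-- `P` is (up to isomorphism) the right DG `B`-module `N ⊗_B (S/Z)`:
universal property among balanced pairings. -/
structure IsTensorSubquot {A B E : DGAlgebra R} (φ : DGAlgHom A B)
    (he : EnvelopingAlg φ E) (S Z : Set E.carrier) (N P : DGModule R B) where
  pairing : TensorPairing φ he S Z N P
  univ : ∀ (W : DGModule R B) (γ : TensorPairing φ he S Z N W),
    ∃ g : DGHom P W, (∀ n x, x ∈ S → g.toFun (pairing.pair n x) = γ.pair n x) ∧
      ∀ g' : DGHom P W, (∀ n x, x ∈ S → g'.toFun (pairing.pair n x) = γ.pair n x) →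
        ∀ p, g'.toFun p = g.toFun p

/-- `Q` is (up to isomorphism) the quotient `S/Z` of DG `B^e`-submodules
`Z ⊆ S ⊆ B^e`, regarded as a right DG `B`-module via `r : B → B^e`. -/
structure SubquotModSpec {A B E : DGAlgebra R} {φ : DGAlgHom A B}
    (he : EnvelopingAlg φ E) (S Z : Set E.carrier) (Q : DGModule R B) where
  q : E.carrier → Q.carrier
  q_add : ∀ x y, x ∈ S → y ∈ S → q (x + y) = q x + q y
  q_rsmul : ∀ (r : R) x, x ∈ S → q (r • x) = r • q x
  q_mem : ∀ {i : ℤ} (x : E.carrier), x ∈ S → x ∈ E.grading i → q x ∈ Q.grading i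
  q_d : ∀ x, x ∈ S → q (E.d x) = Q.d (q x)
  q_act : ∀ (x : E.carrier) (b : B.carrier), x ∈ S →
    q (x * he.r.toFun b) = Q.smul (q x) b
  q_surj : ∀ y, ∃ x ∈ S, q x = y
  q_ker : ∀ x, x ∈ S → (q x = 0 ↔ x ∈ Z)

/-- The data exhibiting `φ : A → B` as DG quasi-smooth, relative to a realization
`E` of the enveloping DG algebra `B^e` and the multiplication map `π_B : B^e → B`:
`B` is graded-free over `A` and the diagonal ideal `J = ker π_B` carries a filtration
`J = J^[1] ⊇ J^[2] ⊇ ⋯` of DG `B^e`-submodules with `J·J^[ℓ] + J^[ℓ]·J ⊆ J^[ℓ+1]`,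
`inf J^[ℓ] ≥ ℓ`, and all subquotients `J^[ℓ]/J^[ℓ+1]` semifree over `B`. -/
structure QuasiSmoothData {A B : DGAlgebra R} (φ : DGAlgHom A B) (E : DGAlgebra R)
    (he : EnvelopingAlg φ E) (πB : DGAlgHom E B) where
  pil : ∀ b, πB.toFun (he.l.toFun b) = b
  pir : ∀ b, πB.toFun (he.r.toFun b) = b
  free : FreeOverBase φ
  filt : ℕ → Set E.carrier
  filt_one : filt 1 = {x | πB.toFun x = 0}
  filt_desc : ∀ ℓ, 1 ≤ ℓ → filt (ℓ + 1) ⊆ filt ℓ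
  filt_zero : ∀ ℓ, (0 : E.carrier) ∈ filt ℓ
  filt_add : ∀ ℓ x y, x ∈ filt ℓ → y ∈ filt ℓ → x + y ∈ filt ℓ
  filt_neg : ∀ ℓ x, x ∈ filt ℓ → -x ∈ filt ℓ
  filt_rsmul : ∀ ℓ (r : R) x, x ∈ filt ℓ → r • x ∈ filt ℓ
  filt_act : ∀ ℓ (e : E.carrier) x, x ∈ filt ℓ → x * e ∈ filt ℓ
  filt_d : ∀ ℓ x, x ∈ filt ℓ → E.d x ∈ filt ℓ
  filt_graded : ∀ ℓ x, x ∈ filt ℓ →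
    x ∈ Submodule.span R (filt ℓ ∩ ⋃ i : ℤ, (E.grading i : Set E.carrier))
  filt_mul : ∀ ℓ, 1 ≤ ℓ → ∀ a x, πB.toFun a = 0 → x ∈ filt ℓ →
    a * x ∈ filt (ℓ + 1) ∧ x * a ∈ filt (ℓ + 1)
  filt_inf : ∀ ℓ : ℕ, 1 ≤ ℓ → ∀ i : ℤ, i < (ℓ : ℤ) →
    ∀ x ∈ filt ℓ, x ∈ E.grading i → x = 0
  quot_semifree : ∀ ℓ, 1 ≤ ℓ → ∃ Q : DGModule R B,
    Nonempty (SubquotModSpec he (filt ℓ) (filt (ℓ + 1)) Q) ∧ IsSemifree Q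

/-- The data exhibiting `φ : A → B` as DG smooth: quasi-smooth, and all
subquotients `J^[ℓ]/J^[ℓ+1]` have finite semifree bases. -/
structure SmoothData {A B : DGAlgebra R} (φ : DGAlgHom A B) (E : DGAlgebra R)
    (he : EnvelopingAlg φ E) (πB : DGAlgHom E B)
    extends QuasiSmoothData φ E he πB where
  quot_finite : ∀ ℓ, 1 ≤ ℓ → ∃ Q : DGModule R B,
    Nonempty (SubquotModSpec he (filt ℓ) (filt (ℓ + 1)) Q) ∧ HasFiniteSemifreeBasis Q

/-- A DG `A`-submodule of a DG `A`-module `M`: an `R`-submodule closed under the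
`A`-action and the differential and generated by homogeneous elements. -/
structure DGSubmodule {A : DGAlgebra R} (M : DGModule R A) where
  toSubmodule : Submodule R M.carrier
  smul_mem' : ∀ (x : M.carrier) (a : A.carrier), x ∈ toSubmodule →
    M.smul x a ∈ toSubmodule
  d_mem' : ∀ x ∈ toSubmodule, M.d x ∈ toSubmodule
  graded' : ∀ x ∈ toSubmodule, x ∈ Submodule.span R
    ((toSubmodule : Set M.carrier) ∩ ⋃ i : ℤ, (M.grading i : Set M.carrier))

/-- `P` (with projections `proj`) is the direct product of the family `Ms` in the
category of DG `A`-modules. -/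
def IsDGProduct {A : DGAlgebra R} (Ms : ℕ → DGModule R A) (P : DGModule R A)
    (proj : ∀ ℓ, DGHom P (Ms ℓ)) : Prop :=
  ∀ (W : DGModule R A) (f : ∀ ℓ, DGHom W (Ms ℓ)),
    ∃ g : DGHom W P, (∀ ℓ x, (proj ℓ).toFun (g.toFun x) = (f ℓ).toFun x) ∧
      ∀ g' : DGHom W P, (∀ ℓ x, (proj ℓ).toFun (g'.toFun x) = (f ℓ).toFun x) →
        ∀ x, g'.toFun x = g.toFun x

/-- `M'` is the `k`-th shift `Σ^k M` of the DG `A`-module `M`. -/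
structure DGShiftSpec {A : DGAlgebra R} (k : ℤ) (M M' : DGModule R A) where
  toFun : M.carrier → M'.carrier
  bij : Function.Bijective toFun
  map_add : ∀ x y, toFun (x + y) = toFun x + toFun y
  map_rsmul : ∀ (r : R) x, toFun (r • x) = r • toFun x
  map_mem : ∀ {i : ℤ} (x : M.carrier), x ∈ M.grading i → toFun x ∈ M'.grading (i + k)
  map_smul : ∀ (x : M.carrier) (a : A.carrier), toFun (M.smul x a) = M'.smul (toFun x) a
  map_d : ∀ x, M'.d (toFun x) = ksign k • toFun (M.d x)

/-- `C` is the mapping cone of `f : X → Y`: a degreewise split extension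
`0 → Y → C → ΣX → 0` whose twisting term is `f`. -/
structure DGConeSpec {A : DGAlgebra R} {X Y : DGModule R A} (f : DGHom X Y)
    (C : DGModule R A) where
  inl : DGHom Y C
  inl_inj : Function.Injective inl.toFun
  pr : GradedHom C X (-1)
  pr_d : ∀ c, pr.toFun (C.d c) = - X.d (pr.toFun c)
  sec : GradedHom X C 1
  pr_sec : ∀ x, pr.toFun (sec.toFun x) = x
  pr_inl : ∀ y, pr.toFun (inl.toFun y) = 0
  split : ∀ c, ∃ y, c = inl.toFun y + sec.toFun (pr.toFun c)
  sec_d : ∀ x, C.d (sec.toFun x) = - sec.toFun (X.d x) + inl.toFun (f.toFun x)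

/-- A system of divided powers on (the homogeneous elements of positive even degree
of) a DG `R`-algebra. -/
structure DGDividedPowers (A : DGAlgebra R) where
  dpow : ℕ → A.carrier → A.carrier
  dpow_zero : ∀ {i : ℤ} (u : A.carrier), 0 < i → Even i → u ∈ A.grading i →
    dpow 0 u = 1
  dpow_one : ∀ {i : ℤ} (u : A.carrier), 0 < i → Even i → u ∈ A.grading i →
    dpow 1 u = u
  dpow_mem : ∀ {i : ℤ} (u : A.carrier) (m : ℕ), 0 < i → Even i → u ∈ A.grading i →
    dpow m u ∈ A.grading ((m : ℤ) * i)
  dpow_mul : ∀ {i : ℤ} (u : A.carrier) (m l : ℕ), 0 < i → Even i → u ∈ A.grading i →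
    dpow m u * dpow l u = ((m + l).choose m : ℤ) • dpow (m + l) u
  dpow_add : ∀ {i : ℤ} (u v : A.carrier) (m : ℕ), 0 < i → Even i →
    u ∈ A.grading i → v ∈ A.grading i →
    dpow m (u + v) = ∑ j ∈ Finset.range (m + 1), dpow j u * dpow (m - j) v
  dpow_odd_mul : ∀ {i j : ℤ} (u v : A.carrier) (m : ℕ), Odd i → Odd j →
    u ∈ A.grading i → v ∈ A.grading j → 2 ≤ m → dpow m (u * v) = 0
  dpow_even_mul : ∀ {i j : ℤ} (u v : A.carrier) (m : ℕ), Even i → Even j → 0 < j →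
    u ∈ A.grading i → v ∈ A.grading j → dpow m (u * v) = u ^ m * dpow m v
  dpow_comp : ∀ {i : ℤ} (u : A.carrier) (m l : ℕ), 0 < i → Even i →
    u ∈ A.grading i → 1 ≤ m →
    dpow l (dpow m u) =
      (Nat.factorial (m * l) / (Nat.factorial l * (Nat.factorial m) ^ l)) •
        dpow (m * l) u

/-- The index set of monomials in variables `ι` (with divided/ordinary powers):
finitely supported exponent functions, with exponents at most `1` on odd-degree
variables. -/
def MonIdx (ι : Type) (degX : ι → ℤ) : Type :=
  {m : ι →₀ ℕ // ∀ i, Odd (degX i) → m i ≤ 1}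

/-- Total weight (number of symbols) of a monomial index. -/
def monWeight {ι : Type} {degX : ι → ℤ} (m : MonIdx ι degX) : ℕ :=
  m.1.sum fun _ k => k

/-- The monomial `∏_i g i (m i)` (product taken in the increasing order of the
variables). -/
def gradMonomial {T : Type} [Ring T] {ι : Type} [LinearOrder ι] (degX : ι → ℤ)
    (g : ι → ℕ → T) (m : MonIdx ι degX) : T :=
  ((m.1.support.sort (· ≤ ·)).map fun i => g i (m.1 i)).prod

/-- `B = A[X_i : i ∈ ι]` is a polynomial extension of `A` by the variables `X_i`
of positive degrees `degX i`, adjoined in increasing order of degree, each `d X_i`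
lying in the preceding stage; the monomials in the `X_i` form a basis of `B` as a
graded `A`-module. -/
structure PolyExt {A B : DGAlgebra R} (φ : DGAlgHom A B) (ι : Type) [LinearOrder ι]
    (X : ι → B.carrier) (degX : ι → ℤ) where
  inj : Function.Injective φ.toFun
  pos_deg : ∀ i, 0 < degX i
  mono_deg : Monotone degX
  homog : ∀ i, X i ∈ B.grading (degX i)
  d_prev : ∀ i : ι, ∃ c : MonIdx ι degX →₀ A.carrier,
    (∀ m ∈ c.support, ∀ j : ι, i ≤ j → m.1 j = 0) ∧
    B.d (X i) = c.sum fun m a =>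
      gradMonomial degX (fun i' k => X i' ^ k) m * φ.toFun a
  basis : Function.Bijective (fun c : MonIdx ι degX →₀ A.carrier =>
    c.sum fun m a => gradMonomial degX (fun i' k => X i' ^ k) m * φ.toFun a)

/-- `B = A⟨X_i : i ∈ ι⟩` is a free (divided power) extension of `A` by the
variables `X_i` of positive degrees: odd variables square to zero, even variables
carry divided powers `dp i m` with `d(X^{(m)}) = X^{(m-1)} dX`, and the divided
power monomials form a basis of `B` as a graded `A`-module. -/
structure FreeExt {A B : DGAlgebra R} (φ : DGAlgHom A B) (ι : Type) [LinearOrder ι]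
    (X : ι → B.carrier) (degX : ι → ℤ) where
  inj : Function.Injective φ.toFun
  pos_deg : ∀ i, 0 < degX i
  mono_deg : Monotone degX
  homog : ∀ i, X i ∈ B.grading (degX i)
  dp : ι → ℕ → B.carrier
  dp_zero : ∀ i, dp i 0 = 1
  dp_one : ∀ i, dp i 1 = X i
  dp_odd : ∀ i m, Odd (degX i) → 2 ≤ m → dp i m = 0
  dp_mem : ∀ i (m : ℕ), dp i m ∈ B.grading ((m : ℤ) * degX i)
  dp_mul : ∀ i (m l : ℕ), dp i m * dp i l = ((m + l).choose m : ℤ) • dp i (m + l)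
  dp_d : ∀ i (m : ℕ), 1 ≤ m → B.d (dp i m) = dp i (m - 1) * B.d (X i)
  d_prev : ∀ i : ι, ∃ c : MonIdx ι degX →₀ A.carrier,
    (∀ m ∈ c.support, ∀ j : ι, i ≤ j → m.1 j = 0) ∧
    B.d (X i) = c.sum fun m a => gradMonomial degX dp m * φ.toFun a
  basis : Function.Bijective (fun c : MonIdx ι degX →₀ A.carrier =>
    c.sum fun m a => gradMonomial degX dp m * φ.toFun a)

/-- The diagonal `ξ_i = X_i^o ⊗ 1 - 1^o ⊗ X_i` of the variable `X_i` in `B^e`. -/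
def xiDiag {A B E : DGAlgebra R} {φ : DGAlgHom A B} (he : EnvelopingAlg φ E)
    {ι : Type} (X : ι → B.carrier) (i : ι) : E.carrier :=
  he.l.toFun (X i) - he.r.toFun (X i)

/-- The divided powers `ξ_i^{(m)} = Σ_{j=0}^m (-1)^{m-j} (X_i^{(j)})^o ⊗ X_i^{(m-j)}`
of the diagonal `ξ_i` in `B^e` (zero for `m ≥ 2` when `|X_i|` is odd). -/
def xiDp {A B E : DGAlgebra R} {φ : DGAlgHom A B} (he : EnvelopingAlg φ E)
    {ι : Type} (dp : ι → ℕ → B.carrier) (degX : ι → ℤ) (i : ι) (m : ℕ) :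
    E.carrier :=
  if Odd (degX i) ∧ 2 ≤ m then 0
  else ∑ j ∈ Finset.range (m + 1),
    ((-1 : ℤ) ^ (m - j)) • (he.l.toFun (dp i j) * he.r.toFun (dp i (m - j)))

/-- The monomial `ξ^{(m)} = ξ_{i_1}^{(m_{i_1})} ⋯ ξ_{i_t}^{(m_{i_t})}` in `B^e`
built from the divided powers of the diagonals. -/
def FreeExt.diagMon {A B E : DGAlgebra R} {φ : DGAlgHom A B}
    {ι : Type} [LinearOrder ι] {X : ι → B.carrier} {degX : ι → ℤ}
    (fe : FreeExt φ ι X degX) (he : EnvelopingAlg φ E) (m : MonIdx ι degX) :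
    E.carrier :=
  gradMonomial degX (xiDp he fe.dp degX) m

/-- The `ℓ`-th power `J^{(ℓ)} = Mon_{≥ℓ}(Ω)·B^e` of the diagonal ideal:
right `B^e`-linear combinations of the `ξ`-monomials of weight at least `ℓ`. -/
def FreeExt.diagPow {A B E : DGAlgebra R} {φ : DGAlgHom A B}
    {ι : Type} [LinearOrder ι] {X : ι → B.carrier} {degX : ι → ℤ}
    (fe : FreeExt φ ι X degX) (he : EnvelopingAlg φ E) (ℓ : ℕ) :
    Set E.carrier :=
  {x | ∃ c : MonIdx ι degX →₀ E.carrier, (∀ m ∈ c.support, ℓ ≤ monWeight m) ∧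
    x = c.sum fun m e => fe.diagMon he m * e}

/-- Ordinary-power analogue `J^ℓ` for polynomial extensions. -/
def PolyExt.diagPow {A B E : DGAlgebra R} {φ : DGAlgHom A B}
    {ι : Type} [LinearOrder ι] {X : ι → B.carrier} {degX : ι → ℤ}
    (_ : PolyExt φ ι X degX) (he : EnvelopingAlg φ E) (ℓ : ℕ) :
    Set E.carrier :=
  {x | ∃ c : MonIdx ι degX →₀ E.carrier, (∀ m ∈ c.support, ℓ ≤ monWeight m) ∧
    x = c.sum fun m e =>
      gradMonomial degX (fun i k => (xiDiag he X i) ^ k) m * e}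

/-- Additive closure of the set of products `a * b` with `a ∈ S₁`, `b ∈ S₂`. -/
def setMulClosure {T : Type} [Ring T] (S₁ S₂ : Set T) : Set T :=
  (AddSubmonoid.closure {x | ∃ a ∈ S₁, ∃ b ∈ S₂, x = a * b} : AddSubmonoid T)

/-- The right ideal generated by a set. -/
def rightIdealGen {T : Type} [Ring T] (S : Set T) : Set T :=
  (AddSubmonoid.closure {x | ∃ s ∈ S, ∃ e : T, x = s * e} : AddSubmonoid T)

/-- The two-sided ideal generated by a set. -/
def twoSidedGen {T : Type} [Ring T] (S : Set T) : Set T :=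
  (AddSubmonoid.closure {x | ∃ s ∈ S, ∃ e e' : T, x = e * s * e'} : AddSubmonoid T)

end

theorem ksign_zero : ksign 0 = 1 := by simp [ksign]

theorem ksign_one : ksign 1 = -1 := by simp [ksign]

theorem ksign_add (i j : ℤ) : ksign (i + j) = ksign i * ksign j := by
  simp [ksign, zpow_add]

theorem ksign_mul_self (i : ℤ) : ksign i * ksign i = 1 := by
  rw [ksign, ← Units.val_mul, Int.units_mul_self, Units.val_one]

theorem ksign_sub_one (i : ℤ) : ksign (i - 1) = -ksign i := by
  rw [sub_eq_add_neg, ksign_add]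
  simp [ksign]

theorem ksign_even {i : ℤ} (h : Even i) : ksign i = 1 := by
  obtain ⟨r, rfl⟩ := h
  rw [ksign_add, ksign_mul_self]

theorem ksign_odd {i : ℤ} (h : Odd i) : ksign i = -1 := by
  obtain ⟨r, rfl⟩ := h
  rw [ksign_add, two_mul, ksign_add, ksign_mul_self, ksign_one, one_mul]

theorem disjoint_iSup_of_projections {R M : Type*} [CommRing R] [AddCommGroup M] [Module R M]
    (G : ℤ → Submodule R M) (p : ℤ → M →ₗ[R] M)
    (h_same : ∀ n, ∀ x ∈ G n, p n x = x) (h_ne : ∀ n j, j ≠ n → ∀ x ∈ G j, p n x = 0) (i : ℤ) :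
    Disjoint (G i) (⨆ j ≠ i, G j) := by
  rw [Submodule.disjoint_def]
  intro x hx hx'
  have : (⨆ j ≠ i, G j) ≤ LinearMap.ker (p i) :=
    iSup₂_le fun j hj y hy => h_ne i j hj y hy
  rw [← h_same i x hx]
  exact this hx'

/-- The homogeneous component of degree `n`, as a linear endomorphism. -/
noncomputable def homogComponent {R M : Type*} [CommRing R] [AddCommGroup M] [Module R M]
    (G : ℤ → Submodule R M) [DirectSum.Decomposition G] (n : ℤ) : M →ₗ[R] M :=
  (G n).subtype ∘ₗ DirectSum.component R ℤ (fun i => G i) n ∘ₗ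
    (DirectSum.decomposeLinearEquiv G).toLinearMap

section homogComponent

variable {R M : Type*} [CommRing R] [AddCommGroup M] [Module R M]
  (G : ℤ → Submodule R M) [DirectSum.Decomposition G]

theorem homogComponent_mem (n : ℤ) (x : M) : homogComponent G n x ∈ G n :=
  (DirectSum.decompose G x n).2

theorem homogComponent_same {n : ℤ} {x : M} (hx : x ∈ G n) : homogComponent G n x = x :=
  DirectSum.decompose_of_mem_same G hx

theorem homogComponent_ne {n j : ℤ} {x : M} (hx : x ∈ G j) (h : j ≠ n) :
    homogComponent G n x = 0 :=
  DirectSum.decompose_of_mem_ne G hx h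

theorem eq_sum_homogComponent (x : M) : ∃ s : Finset ℤ, ∑ i ∈ s, homogComponent G i x = x := by
  classical
  exact ⟨_, DirectSum.sum_support_decompose G x⟩

end homogComponent

noncomputable section

variable {R : Type} [CommRing R]

instance DGAlgebra.gradedAlgebra (B : DGAlgebra R) : GradedAlgebra B.grading :=
  { one_mem := B.one_mem
    mul_mem := fun _ _ _ _ ha hb => B.mul_mem ha hb
    toDecomposition := (DirectSum.isInternal_submodule_of_iSupIndep_of_iSup_eq_top
      B.indep B.spanning).chooseDecomposition }

instance DGModule.decomposition {B : DGAlgebra R} (M : DGModule R B) :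
    DirectSum.Decomposition M.grading :=
  (DirectSum.isInternal_submodule_of_iSupIndep_of_iSup_eq_top
    M.indep M.spanning).chooseDecomposition

theorem DGAlgebra.homogeneous_induction (B : DGAlgebra R) {p : B.carrier → Prop}
    (zero : p 0) (homog : ∀ i, ∀ x ∈ B.grading i, p x) (add : ∀ x y, p x → p y → p (x + y))
    (x : B.carrier) : p x :=
  Submodule.iSup_induction B.grading (motive := p) (x := x)
    (by rw [B.spanning]; exact Submodule.mem_top) homog zero add

theorem DGModule.homogeneous_induction {B : DGAlgebra R} (M : DGModule R B)
    {p : M.carrier → Prop}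
    (zero : p 0) (homog : ∀ i, ∀ x ∈ M.grading i, p x) (add : ∀ x y, p x → p y → p (x + y))
    (x : M.carrier) : p x :=
  Submodule.iSup_induction M.grading (motive := p) (x := x)
    (by rw [M.spanning]; exact Submodule.mem_top) homog zero add

namespace DGAlgebra

/-- The differential as a linear map. -/
def dLin (B : DGAlgebra R) : B.carrier →ₗ[R] B.carrier where
  toFun := B.d
  map_add' := B.d_add
  map_smul' := B.d_rsmul

theorem dLin_apply (B : DGAlgebra R) (b : B.carrier) : B.dLin b = B.d b := rfl

/-- The linear endomorphism acting as `(-1)^i` in degree `i`. -/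
def signLin (B : DGAlgebra R) : B.carrier →ₗ[R] B.carrier :=
  DirectSum.toModule R ℤ B.carrier (fun i => ksign i • (B.grading i).subtype) ∘ₗ
    (DirectSum.decomposeLinearEquiv B.grading).toLinearMap

theorem signLin_apply (B : DGAlgebra R) {i : ℤ} {b : B.carrier} (hb : b ∈ B.grading i) :
    B.signLin b = ksign i • b := by
  lift b to B.grading i using hb
  simp [signLin]

theorem d_zero (B : DGAlgebra R) : B.d 0 = 0 := map_zero B.dLin
theorem d_sub (B : DGAlgebra R) (b c : B.carrier) : B.d (b - c) = B.d b - B.d c :=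
  map_sub B.dLin b c

theorem d_one (B : DGAlgebra R) : B.d 1 = 0 := by
  have := B.leibniz 1 1 B.one_mem
  simpa [ksign_zero] using this

end DGAlgebra

namespace DGAlgHom

variable {A B : DGAlgebra R}

/-- The underlying linear map. -/
def lin (f : DGAlgHom A B) : A.carrier →ₗ[R] B.carrier where
  toFun := f.toFun
  map_add' := f.map_add
  map_smul' := f.map_rsmul

theorem lin_apply (f : DGAlgHom A B) (a : A.carrier) : f.lin a = f.toFun a := rfl

theorem map_zero (f : DGAlgHom A B) : f.toFun 0 = 0 := _root_.map_zero f.lin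
theorem map_sub (f : DGAlgHom A B) (a b : A.carrier) : f.toFun (a - b) = f.toFun a - f.toFun b :=
  _root_.map_sub f.lin a b

end DGAlgHom

namespace DGModule

variable {B : DGAlgebra R} (M : DGModule R B)

/-- The differential as a linear map. -/
def dLin : M.carrier →ₗ[R] M.carrier where
  toFun := M.d
  map_add' := M.d_add
  map_smul' := M.d_rsmul

/-- The action as a bilinear map. -/
def act : M.carrier →ₗ[R] B.carrier →ₗ[R] M.carrier :=
  LinearMap.mk₂ R M.smul M.add_smul M.rsmul_smul M.smul_add M.smul_rsmul

theorem d_zero : M.d 0 = 0 := map_zero M.dLin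
theorem d_sub (x y : M.carrier) : M.d (x - y) = M.d x - M.d y := map_sub M.dLin x y
theorem smul_zero (m : M.carrier) : M.smul m 0 = 0 := map_zero (M.act m)
theorem zero_smul (a : B.carrier) : M.smul 0 a = 0 := M.act.map_zero₂ a
theorem sub_smul (m n : M.carrier) (a : B.carrier) :
    M.smul (m - n) a = M.smul m a - M.smul n a := M.act.map_sub₂ m n a
theorem zsmul_smul (k : ℤ) (m : M.carrier) (a : B.carrier) :
    M.smul (k • m) a = k • M.smul m a := map_zsmul (M.act.flip a) k m

end DGModule

/-- The underlying linear map. -/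
def DGHom.lin {B : DGAlgebra R} {M N : DGModule R B} (f : DGHom M N) :
    M.carrier →ₗ[R] N.carrier where
  toFun := f.toFun
  map_add' := f.map_add
  map_smul' := f.map_rsmul

/-- The underlying linear map. -/
def ResHomB.lin {A B : DGAlgebra R} {φ : DGAlgHom A B} {M N : DGModule R B}
    (f : ResHomB φ M N) : M.carrier →ₗ[R] N.carrier where
  toFun := f.toFun
  map_add' := f.map_add
  map_smul' := f.map_rsmul

end

noncomputable section

open TensorProduct

variable {R : Type} [CommRing R] {A B : DGAlgebra R}

namespace SelfTensor

/-- The graded tensor product `B ⊗_R B`. -/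
abbrev Total (B : DGAlgebra R) : Type := GradedTensorProduct R B.grading B.grading

theorem tmul_mul_tmul {i j : ℤ} (b b' c c' : B.carrier) (hb' : b' ∈ B.grading j)
    (hc : c ∈ B.grading i) :
    (GradedTensorProduct.tmul R b b' * GradedTensorProduct.tmul R c c' : Total B) =
      ksign (j * i) • GradedTensorProduct.tmul R (b * c) (b' * c') := by
  have := GradedTensorProduct.tmul_coe_mul_coe_tmul B.grading B.grading b ⟨b', hb'⟩ ⟨c, hc⟩ c'
  rw [Units.smul_def] at this
  exact this

/-- `tmul` as a bilinear map into `Total B`. -/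
def totalMk (B : DGAlgebra R) : B.carrier →ₗ[R] B.carrier →ₗ[R] Total B :=
  (TensorProduct.mk R B.carrier B.carrier).compr₂
    (GradedTensorProduct.of R B.grading B.grading).toLinearMap

theorem totalMk_mul {i j : ℤ} (b b' c c' : B.carrier) (hb' : b' ∈ B.grading j)
    (hc : c ∈ B.grading i) :
    totalMk B b b' * totalMk B c c' = ksign (j * i) • totalMk B (b * c) (b' * c') :=
  tmul_mul_tmul b b' c c' hb' hc

theorem total_induction {p : Total B → Prop} (zero : p 0)
    (tmul : ∀ i j, ∀ b ∈ B.grading i, ∀ b' ∈ B.grading j, p (totalMk B b b'))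
    (add : ∀ x y, p x → p y → p (x + y)) (x : Total B) : p x := by
  refine TensorProduct.induction_on (motive := p) x zero (fun b b' => ?_) add
  change p (totalMk B b b')
  refine B.homogeneous_induction (p := fun b => p (totalMk B b b')) ?_ (fun i b hb => ?_) ?_ b
  · rw [LinearMap.map_zero₂]; exact zero
  · refine B.homogeneous_induction (p := fun b' => p (totalMk B b b')) ?_ (fun j b' hb' => ?_) ?_ b'
    · rw [map_zero]; exact zero
    · exact tmul i j b hb b' hb'
    · intro x y hx hy; rw [map_add]; exact add _ _ hx hy
  · intro x y hx hy; rw [LinearMap.map_add₂]; exact add _ _ hx hy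

/-- The relations `b φ(a) ⊗ c = b ⊗ φ(a) c`. -/
def relations (φ : DGAlgHom A B) : Submodule R (Total B) :=
  Submodule.span R {x | ∃ (i j k : ℤ) (b : B.carrier) (a : A.carrier) (b' : B.carrier),
    b ∈ B.grading i ∧ a ∈ A.grading j ∧ b' ∈ B.grading k ∧
    x = totalMk B (b * φ.toFun a) b' - totalMk B b (φ.toFun a * b')}

variable (φ : DGAlgHom A B)

theorem mul_mem_relations (y : Total B) {x : Total B} (hx : x ∈ relations φ) :
    y * x ∈ relations φ := by
  refine Submodule.span_induction (p := fun x _ => y * x ∈ relations φ) ?_ (by simp)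
    (fun _ _ _ _ h h' => by rw [mul_add]; exact add_mem h h')
    (fun r _ _ h => by rw [GradedTensorProduct.mul_def, map_smul]; exact Submodule.smul_mem _ r h) hx
  rintro _ ⟨i, j, k, b, a, b', hb, ha, hb', rfl⟩
  induction y using total_induction with
  | zero => simp
  | add _ _ h h' => rw [add_mul]; exact add_mem h h'
  | tmul l m c hc c' hc' =>
    rw [mul_sub, totalMk_mul c c' _ _ hc' (B.mul_mem hb (φ.map_mem ha)),
      totalMk_mul c c' _ _ hc' hb, ← mul_assoc c', B.gcomm c' _ hc' (φ.map_mem ha),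
      smul_mul_assoc, map_zsmul, smul_smul, ← ksign_add, ← mul_add, ← smul_sub, ← mul_assoc c,
      mul_assoc _ c']
    refine zsmul_mem (Submodule.subset_span ?_) _
    exact ⟨_, _, _, _, _, _, B.mul_mem hc hb, ha, B.mul_mem hc' hb', rfl⟩

theorem relations_mul_mem {x : Total B} (hx : x ∈ relations φ) (y : Total B) :
    x * y ∈ relations φ := by
  refine Submodule.span_induction (p := fun x _ => x * y ∈ relations φ) ?_ (by simp)
    (fun _ _ _ _ h h' => by rw [add_mul]; exact add_mem h h')
    (fun r _ _ h => by rw [GradedTensorProduct.mul_def, LinearMap.map_smul₂]; exact Submodule.smul_mem _ r h) hx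
  rintro _ ⟨i, j, k, b, a, b', hb, ha, hb', rfl⟩
  induction y using total_induction with
  | zero => simp
  | add _ _ h h' => rw [mul_add]; exact add_mem h h'
  | tmul l m c hc c' hc' =>
    rw [sub_mul, totalMk_mul _ _ c c' (B.mul_mem (φ.map_mem ha) hb') hc,
      totalMk_mul _ _ c c' hb' hc, mul_assoc b, B.gcomm _ c (φ.map_mem ha) hc,
      mul_smul_comm, map_zsmul, LinearMap.smul_apply, smul_smul, ← ksign_add, ← add_mul,
      add_comm k, ← smul_sub, ← mul_assoc b, mul_assoc _ b']
    refine zsmul_mem (Submodule.subset_span ?_) _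
    exact ⟨_, _, _, _, _, _, B.mul_mem hb hc, ha, B.mul_mem hb' hc', rfl⟩

/-- The relations as an ideal. -/
def relIdeal : Ideal (Total B) :=
  { relations φ with smul_mem' := fun y _ hx => mul_mem_relations φ y hx }

instance : (relIdeal φ).IsTwoSided := ⟨fun y hx => relations_mul_mem φ hx y⟩

/-- The ring `B ⊗_A B`. -/
def Tens : Type := Total B ⧸ relIdeal φ

instance : Ring (Tens φ) := inferInstanceAs (Ring (Total B ⧸ relIdeal φ))

instance : Algebra R (Tens φ) := inferInstanceAs (Algebra R (Total B ⧸ relIdeal φ))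

/-- The quotient map onto `B ⊗_A B`. -/
def toTens : Total B →ₐ[R] Tens φ := Ideal.Quotient.mkₐ R (relIdeal φ)

theorem toTens_surjective : Function.Surjective (toTens φ) := Ideal.Quotient.mk_surjective

/-- The class of `b ⊗ b'` in `B ⊗_A B`. -/
def mk : B.carrier →ₗ[R] B.carrier →ₗ[R] Tens φ :=
  (totalMk B).compr₂ (toTens φ).toLinearMap

theorem mk_apply (b b' : B.carrier) : mk φ b b' = toTens φ (totalMk B b b') := rfl

theorem mk_one_one : mk φ 1 1 = 1 := map_one (toTens φ)

theorem mk_mul_mk {i j : ℤ} (b b' c c' : B.carrier) (hb' : b' ∈ B.grading j)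
    (hc : c ∈ B.grading i) :
    mk φ b b' * mk φ c c' = ksign (j * i) • mk φ (b * c) (b' * c') := by
  rw [mk_apply, mk_apply, ← map_mul, totalMk_mul b b' c c' hb' hc, map_zsmul]
  rfl

variable {φ}

theorem tens_induction {p : Tens φ → Prop} (zero : p 0)
    (mk : ∀ i j, ∀ b ∈ B.grading i, ∀ b' ∈ B.grading j, p (mk φ b b'))
    (add : ∀ x y, p x → p y → p (x + y)) (x : Tens φ) : p x := by
  obtain ⟨x, rfl⟩ := toTens_surjective φ x
  induction x using total_induction with
  | zero => rw [map_zero]; exact zero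
  | tmul i j b hb b' hb' => exact mk i j b hb b' hb'
  | add x y hx hy => rw [map_add]; exact add _ _ hx hy

variable (φ)

theorem mk_balanced {i j k : ℤ} {b b' : B.carrier} {a : A.carrier} (hb : b ∈ B.grading i)
    (ha : a ∈ A.grading j) (hb' : b' ∈ B.grading k) :
    mk φ (b * φ.toFun a) b' = mk φ b (φ.toFun a * b') := by
  refine (Ideal.Quotient.eq (I := relIdeal φ)).2 ?_
  exact Submodule.subset_span ⟨_, _, _, _, _, _, hb, ha, hb', rfl⟩

/-- Linear maps out of `B ⊗_A B` from balanced bilinear maps. -/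
def lift {V : Type*} [AddCommGroup V] [Module R V] (β : B.carrier →ₗ[R] B.carrier →ₗ[R] V)
    (hβ : ∀ i j k, ∀ b ∈ B.grading i, ∀ a ∈ A.grading j, ∀ b' ∈ B.grading k,
      β (b * φ.toFun a) b' = β b (φ.toFun a * b')) : Tens φ →ₗ[R] V :=
  ((relIdeal φ).restrictScalars R).liftQ
      (TensorProduct.lift β ∘ₗ (GradedTensorProduct.of R B.grading B.grading).symm.toLinearMap) (by
    change relations φ ≤ _
    rw [relations, Submodule.span_le]
    rintro _ ⟨i, j, k, b, a, b', hb, ha, hb', rfl⟩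
    simp only [SetLike.mem_coe, LinearMap.mem_ker, map_sub, sub_eq_zero]
    exact hβ i j k b hb a ha b' hb') ∘ₗ
  (Submodule.Quotient.restrictScalarsEquiv R (relIdeal φ)).symm.toLinearMap

theorem lift_mk {V : Type*} [AddCommGroup V] [Module R V]
    (β : B.carrier →ₗ[R] B.carrier →ₗ[R] V)
    (hβ : ∀ i j k, ∀ b ∈ B.grading i, ∀ a ∈ A.grading j, ∀ b' ∈ B.grading k,
      β (b * φ.toFun a) b' = β b (φ.toFun a * b')) (b b' : B.carrier) :
    lift φ β hβ (mk φ b b') = β b b' := rfl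

end SelfTensor
end

theorem ksign_eq_or (i : ℤ) : ksign i = 1 ∨ ksign i = -1 := by
  rcases Int.even_or_odd i with h | h
  · exact Or.inl (ksign_even h)
  · exact Or.inr (ksign_odd h)

theorem ksign_sub (i j : ℤ) : ksign (i - j) = ksign i * ksign j := by
  have := ksign_add (i - j) j
  rw [sub_add_cancel] at this
  rw [this, mul_assoc, ksign_mul_self, mul_one]

noncomputable section

open TensorProduct

variable {R : Type} [CommRing R] {A B : DGAlgebra R}

namespace SelfTensor

variable (φ : DGAlgHom A B)

/-- The grading of `B ⊗_A B` by total degree. -/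
def grading (n : ℤ) : Submodule R (Tens φ) :=
  Submodule.span R {x | ∃ (i j : ℤ) (b b' : B.carrier), i + j = n ∧ b ∈ B.grading i ∧
    b' ∈ B.grading j ∧ x = mk φ b b'}

variable {φ} in
theorem mk_mem_of_eq {i j n : ℤ} (h : i + j = n) {b b' : B.carrier} (hb : b ∈ B.grading i)
    (hb' : b' ∈ B.grading j) : mk φ b b' ∈ grading φ n :=
  Submodule.subset_span ⟨i, j, b, b', h, hb, hb', rfl⟩

variable {φ} in
theorem mk_mem {i j : ℤ} {b b' : B.carrier} (hb : b ∈ B.grading i) (hb' : b' ∈ B.grading j) :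
    mk φ b b' ∈ grading φ (i + j) :=
  mk_mem_of_eq rfl hb hb'

variable {φ} in
@[elab_as_elim]
theorem grading_induction {n : ℤ} {p : Tens φ → Prop} {x : Tens φ} (hx : x ∈ grading φ n)
    (zero : p 0)
    (mk : ∀ i j, i + j = n → ∀ b ∈ B.grading i, ∀ b' ∈ B.grading j, p (mk φ b b'))
    (add : ∀ x y, p x → p y → p (x + y)) (smul : ∀ (r : R) x, p x → p (r • x)) : p x := by
  refine Submodule.span_induction (p := fun x _ => p x) ?_ zero (fun x y _ _ => add x y)
    (fun r x _ => smul r x) hx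
  rintro _ ⟨i, j, b, b', h, hb, hb', rfl⟩
  exact mk i j h b hb b' hb'

/-- The bilinear map inducing the projection of `B ⊗_A B` onto its degree `n` part. -/
def projBilin (n : ℤ) : B.carrier →ₗ[R] B.carrier →ₗ[R] Tens φ :=
  DirectSum.toModule R ℤ _ (fun i =>
    ((mk φ).compl₂ (homogComponent B.grading (n - i))) ∘ₗ (B.grading i).subtype) ∘ₗ
    (DirectSum.decomposeLinearEquiv B.grading).toLinearMap

theorem projBilin_apply (n : ℤ) {i : ℤ} {b : B.carrier} (hb : b ∈ B.grading i)
    (b' : B.carrier) :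
    projBilin φ n b b' = mk φ b (homogComponent B.grading (n - i) b') := by
  lift b to B.grading i using hb
  simp [projBilin]

/-- The projection of `B ⊗_A B` onto its degree `n` part. -/
def proj (n : ℤ) : Tens φ →ₗ[R] Tens φ :=
  lift φ (projBilin φ n) (by
    intro i j k b hb a ha b' hb'
    rw [projBilin_apply φ n hb, projBilin_apply φ n (B.mul_mem hb (φ.map_mem ha))]
    by_cases h : k = n - (i + j)
    · rw [homogComponent_same _ (h ▸ hb'), mk_balanced φ hb ha hb',
        homogComponent_same _ (by convert B.mul_mem (φ.map_mem ha) hb' using 1; grind)]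
    · rw [homogComponent_ne _ hb' h, homogComponent_ne _ (B.mul_mem (φ.map_mem ha) hb') (by grind),
        map_zero, map_zero])

theorem proj_mk (n : ℤ) {i : ℤ} {b : B.carrier} (hb : b ∈ B.grading i) (b' : B.carrier) :
    proj φ n (mk φ b b') = mk φ b (homogComponent B.grading (n - i) b') := by
  rw [proj, lift_mk, projBilin_apply φ n hb]

/-- The differential of `B ⊗_A B`. -/
def diff : Tens φ →ₗ[R] Tens φ :=
  lift φ ((mk φ) ∘ₗ B.dLin + ((mk φ) ∘ₗ B.signLin).compl₂ B.dLin) (by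
    intro i j k b hb a ha b' hb'
    have h₁ := mk_balanced φ (B.d_mem hb) ha hb'
    have h₂ := mk_balanced φ hb (A.d_mem ha) hb'
    have h₃ := mk_balanced φ hb ha (B.d_mem hb')
    simp only [LinearMap.add_apply, LinearMap.comp_apply, LinearMap.compl₂_apply,
      DGAlgebra.dLin_apply, B.signLin_apply hb, B.signLin_apply (B.mul_mem hb (φ.map_mem ha)),
      B.leibniz _ _ hb, B.leibniz _ _ (φ.map_mem ha), map_add, map_zsmul, LinearMap.smul_apply,
      ← φ.comm_d, h₁, h₂, h₃, ksign_add, mul_smul, add_assoc, smul_comm (ksign j)])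

theorem diff_mk {i : ℤ} {b : B.carrier} (hb : b ∈ B.grading i) (b' : B.carrier) :
    diff φ (mk φ b b') = mk φ (B.d b) b' + ksign i • mk φ b (B.d b') := by
  simp only [diff, lift_mk, LinearMap.add_apply, LinearMap.comp_apply, LinearMap.compl₂_apply,
    DGAlgebra.dLin_apply, B.signLin_apply hb, map_zsmul, LinearMap.smul_apply]

theorem diff_mem {n : ℤ} {x : Tens φ} (hx : x ∈ grading φ n) : diff φ x ∈ grading φ (n - 1) := by
  refine grading_induction hx (by simp) ?_ (fun _ _ h h' => by rw [map_add]; exact add_mem h h')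
    (fun r _ h => by rw [map_smul]; exact Submodule.smul_mem _ r h)
  rintro i j rfl b hb b' hb'
  rw [diff_mk φ hb]
  refine add_mem ?_ (zsmul_mem ?_ _)
  · convert mk_mem (B.d_mem hb) hb' using 2; ring
  · convert mk_mem hb (B.d_mem hb') using 2; ring

theorem diff_diff (x : Tens φ) : diff φ (diff φ x) = 0 := by
  induction x using tens_induction with
  | zero => simp
  | add x y hx hy => simp [hx, hy]
  | mk i j b hb b' hb' =>
    rw [diff_mk φ hb, map_add, map_zsmul, diff_mk φ hb, diff_mk φ (B.d_mem hb), B.d_sq, B.d_sq]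
    simp [ksign_sub_one]

theorem diff_mul {n : ℤ} {x : Tens φ} (hx : x ∈ grading φ n) (y : Tens φ) :
    diff φ (x * y) = diff φ x * y + ksign n • (x * diff φ y) := by
  refine grading_induction hx (by simp) ?_
    (fun x x' h h' => by simp only [add_mul, map_add, h, h', smul_add]; abel)
    (fun r x h => by
      simp only [map_smul, smul_mul_assoc, h, smul_add, smul_comm r (ksign n)])
  rintro i j rfl b hb b' hb'
  induction y using tens_induction with
  | zero => simp
  | add y y' h h' => simp only [mul_add, map_add, h, h', smul_add]; abel
  | mk k l c hc c' hc' =>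
    rw [mk_mul_mk φ b b' c c' hb' hc, map_zsmul, diff_mk φ (B.mul_mem hb hc), diff_mk φ hb,
      diff_mk φ hc, add_mul, mul_add, smul_mul_assoc, mul_smul_comm,
      mk_mul_mk φ _ _ _ _ hb' hc, mk_mul_mk φ _ _ _ _ (B.d_mem hb') hc,
      mk_mul_mk φ _ _ _ _ hb' (B.d_mem hc), mk_mul_mk φ _ _ _ _ hb' hc,
      B.leibniz _ _ hb, B.leibniz _ _ hb', sub_mul, mul_sub, mul_one, one_mul]
    simp only [map_add, map_zsmul, LinearMap.add_apply, LinearMap.smul_apply, ksign_add, ksign_sub]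
    rcases ksign_eq_or i with hi | hi <;> rcases ksign_eq_or j with hj | hj <;>
      rcases ksign_eq_or k with hk | hk <;> rcases ksign_eq_or (j * k) with h | h <;>
      simp only [hi, hj, hk, h] <;> module

theorem graded_comm {m n : ℤ} {x y : Tens φ} (hx : x ∈ grading φ m) (hy : y ∈ grading φ n) :
    x * y = ksign (m * n) • (y * x) := by
  refine grading_induction hx (by simp) ?_
    (fun x x' h h' => by simp only [add_mul, mul_add, h, h', smul_add])
    (fun r x h => by simp only [smul_mul_assoc, mul_smul_comm, h, smul_comm r (ksign _)])
  rintro i j rfl b hb b' hb'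
  refine grading_induction hy (by simp) ?_
    (fun x x' h h' => by simp only [add_mul, mul_add, h, h', smul_add])
    (fun r x h => by simp only [smul_mul_assoc, mul_smul_comm, h, smul_comm r (ksign _)])
  rintro k l rfl c hc c' hc'
  rw [mk_mul_mk φ _ _ _ _ hb' hc, mk_mul_mk φ _ _ _ _ hc' hb, B.gcomm b c hb hc,
    B.gcomm b' c' hb' hc']
  simp only [map_zsmul, LinearMap.smul_apply, smul_smul, add_mul, mul_add, ksign_add,
    mul_comm l i]
  congr 1
  linear_combination (-ksign (j * k) * ksign (i * k) * ksign (j * l)) * ksign_mul_self (i * l)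

theorem odd_mul_self {n : ℤ} (hn : Odd n) {x : Tens φ} (hx : x ∈ grading φ n) : x * x = 0 := by
  refine Submodule.span_induction (p := fun x _ => x * x = 0) ?_ (by simp) ?_ ?_ hx
  · rintro _ ⟨i, j, b, b', rfl, hb, hb', rfl⟩
    rw [mk_mul_mk φ _ _ _ _ hb' hb]
    rcases Int.even_or_odd i with hi | hi
    · rw [B.odd_sq b' (by grind) hb']; simp
    · rw [B.odd_sq b hi hb]; simp
  · intro x y hx hy hxx hyy
    have := graded_comm φ hx hy
    rw [ksign_odd (hn.mul hn)] at this
    simp [add_mul, mul_add, hxx, hyy, this]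
  · intro r x _ h
    simp [h]

theorem mul_mem {m n : ℤ} {x y : Tens φ} (hx : x ∈ grading φ m) (hy : y ∈ grading φ n) :
    x * y ∈ grading φ (m + n) := by
  refine grading_induction hx (by simp) ?_ (fun x x' h h' => by rw [add_mul]; exact add_mem h h')
    (fun r x h => by rw [smul_mul_assoc]; exact Submodule.smul_mem _ r h)
  rintro i j rfl b hb b' hb'
  refine grading_induction hy (by simp) ?_ (fun x x' h h' => by rw [mul_add]; exact add_mem h h')
    (fun r x h => by rw [mul_smul_comm]; exact Submodule.smul_mem _ r h)
  rintro k l rfl c hc c' hc'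
  rw [mk_mul_mk φ _ _ _ _ hb' hc]
  refine zsmul_mem ?_ _
  convert mk_mem (B.mul_mem hb hc) (B.mul_mem hb' hc') using 2
  ring

theorem disjoint_grading (n : ℤ) : Disjoint (grading φ n) (⨆ j ≠ n, grading φ j) := by
  refine disjoint_iSup_of_projections _ (proj φ) (fun n x hx => ?_) (fun n j hj x hx => ?_) n
  · refine grading_induction hx (by simp) ?_ (fun _ _ h h' => by rw [map_add, h, h'])
      (fun _ _ h => by rw [map_smul, h])
    rintro i j rfl b hb b' hb'
    rw [proj_mk φ _ hb, homogComponent_same _ (by rwa [add_sub_cancel_left])]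
  · refine grading_induction hx (by simp) ?_ (fun _ _ h h' => by rw [map_add, h, h', add_zero])
      (fun _ _ h => by rw [map_smul, h, smul_zero])
    rintro i k rfl b hb b' hb'
    rw [proj_mk φ _ hb, homogComponent_ne _ hb' (by grind), map_zero]

theorem iSup_grading : ⨆ n, grading φ n = ⊤ := by
  rw [eq_top_iff]
  rintro x -
  induction x using tens_induction with
  | zero => exact zero_mem _
  | add x y hx hy => exact add_mem hx hy
  | mk i j b hb b' hb' => exact Submodule.mem_iSup_of_mem (i + j) (mk_mem hb hb')

theorem grading_of_neg (n : ℤ) (hn : n < 0) : grading φ n = ⊥ := by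
  rw [eq_bot_iff]
  intro x hx
  refine grading_induction hx (zero_mem _) ?_ (fun _ _ => add_mem)
    (fun r _ h => Submodule.smul_mem _ r h)
  rintro i j rfl b hb b' hb'
  rcases lt_or_ge i 0 with hi | hi
  · rw [B.nonneg i hi, Submodule.mem_bot] at hb
    simp [hb]
  · rw [B.nonneg j (by omega), Submodule.mem_bot] at hb'
    simp [hb']

theorem one_mem_grading : (1 : Tens φ) ∈ grading φ 0 := by
  rw [← mk_one_one φ]
  exact mk_mem_of_eq (add_zero 0) B.one_mem B.one_mem

/-- The DG algebra `B ⊗_A B`. -/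
def dgAlgebra : DGAlgebra R where
  carrier := Tens φ
  grading := grading φ
  indep := disjoint_grading φ
  spanning := iSup_grading φ
  nonneg := grading_of_neg φ
  one_mem := one_mem_grading φ
  mul_mem ha hb := mul_mem φ ha hb
  gcomm _ _ ha hb := graded_comm φ ha hb
  odd_sq _ hi ha := odd_mul_self φ hi ha
  d := diff φ
  d_add := (diff φ).map_add
  d_rsmul := (diff φ).map_smul
  d_mem ha := diff_mem φ ha
  d_sq := diff_diff φ
  leibniz _ y hx := diff_mul φ hx y

end SelfTensor
end

noncomputable section

variable {R : Type} [CommRing R] {A B : DGAlgebra R}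

namespace SelfTensor

variable (φ : DGAlgHom A B)

theorem mk_mul_mk_one_left (b c c' : B.carrier) : mk φ b 1 * mk φ c c' = mk φ (b * c) c' := by
  induction c using B.homogeneous_induction with
  | zero => simp
  | add x y hx hy => simp only [map_add, LinearMap.add_apply, mul_add, hx, hy]
  | homog i c hc =>
    rw [mk_mul_mk φ b 1 c c' B.one_mem hc, zero_mul, ksign_zero, one_smul, one_mul]

theorem mk_mul_mk_one_right (b b' c' : B.carrier) :
    mk φ b b' * mk φ 1 c' = mk φ b (b' * c') := by
  induction b' using B.homogeneous_induction with
  | zero => simp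
  | add x y hx hy => simp only [map_add, add_mul, hx, hy]
  | homog i b' hb' =>
    rw [mk_mul_mk φ b b' 1 c' hb' B.one_mem, mul_zero, ksign_zero, one_smul, mul_one]

theorem mk_map_left (a : A.carrier) : mk φ (φ.toFun a) 1 = mk φ 1 (φ.toFun a) := by
  induction a using A.homogeneous_induction with
  | zero => simp [φ.map_zero]
  | add x y hx hy => rw [φ.map_add, map_add, map_add, LinearMap.add_apply, hx, hy]
  | homog i a ha => simpa using mk_balanced φ B.one_mem ha B.one_mem

/-- The map `b ↦ b ⊗ 1`. -/
def inl : DGAlgHom B (dgAlgebra φ) where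
  toFun b := mk φ b 1
  map_one := mk_one_one φ
  map_mul b c := (mk_mul_mk_one_left φ b c 1).symm
  map_add b c := LinearMap.map_add₂ (mk φ) b c 1
  map_rsmul := ((mk φ).flip 1).map_smul
  map_mem {i} b hb := mk_mem_of_eq (add_zero i) hb B.one_mem
  comm_d b := by
    change mk φ (B.d b) 1 = diff φ (mk φ b 1)
    induction b using B.homogeneous_induction with
    | zero => simp [B.d_zero]
    | add x y hx hy => simp only [B.d_add, map_add, LinearMap.add_apply, hx, hy]
    | homog i b hb => simp [diff_mk φ hb, B.d_one]

/-- The map `b ↦ 1 ⊗ b`. -/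
def inr : DGAlgHom B (dgAlgebra φ) where
  toFun b := mk φ 1 b
  map_one := mk_one_one φ
  map_mul b c := (mk_mul_mk_one_right φ 1 b c).symm
  map_add := (mk φ 1).map_add
  map_rsmul := (mk φ 1).map_smul
  map_mem {i} b hb := mk_mem_of_eq (zero_add i) B.one_mem hb
  comm_d b := by
    change mk φ 1 (B.d b) = diff φ (mk φ 1 b)
    simp [diff_mk φ B.one_mem, B.d_one, ksign_zero]

theorem inl_mul_inr (b b' : B.carrier) : (inl φ).toFun b * (inr φ).toFun b' = mk φ b b' :=
  (mk_mul_mk_one_right φ b 1 b').trans (by rw [one_mul])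

variable {φ} {C : DGAlgebra R} (f g : DGAlgHom B C)
  (h : ∀ a, f.toFun (φ.toFun a) = g.toFun (φ.toFun a))

/-- The linear map `b ⊗ c ↦ f b * g c`. -/
def foldLin : Tens φ →ₗ[R] C.carrier :=
  lift φ ((LinearMap.mul R C.carrier).compl₁₂ f.lin g.lin) (by
    intro i j k b hb a ha b' hb'
    simp only [LinearMap.compl₁₂_apply, LinearMap.mul_apply', DGAlgHom.lin_apply, f.map_mul,
      g.map_mul, h, mul_assoc])

theorem foldLin_mk (b b' : B.carrier) : foldLin f g h (mk φ b b') = f.toFun b * g.toFun b' := rfl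

theorem foldLin_mul (x y : Tens φ) :
    foldLin f g h (x * y) = foldLin f g h x * foldLin f g h y := by
  induction x using tens_induction with
  | zero => simp
  | add x x' hx hx' => rw [map_add, add_mul, add_mul, map_add, hx, hx']
  | mk i j b hb b' hb' =>
  induction y using tens_induction with
  | zero => simp
  | add x x' hx hx' => rw [map_add, mul_add, mul_add, map_add, hx, hx']
  | mk k l c hc c' hc' =>
    rw [mk_mul_mk φ _ _ _ _ hb' hc, map_zsmul, foldLin_mk, foldLin_mk, foldLin_mk,
      f.map_mul, g.map_mul, mul_assoc, mul_assoc, ← mul_assoc (g.toFun b'),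
      C.gcomm _ _ (g.map_mem hb') (f.map_mem hc)]
    simp only [smul_mul_assoc, mul_smul_comm, mul_assoc]

/-- The homomorphism `b ⊗ b' ↦ f b * g b'` out of `B ⊗_A B`. -/
def fold : DGAlgHom (dgAlgebra φ) C where
  toFun := foldLin f g h
  map_one := by
    change foldLin f g h 1 = 1
    rw [← mk_one_one, foldLin_mk, f.map_one, g.map_one, one_mul]
  map_mul := foldLin_mul f g h
  map_add := (foldLin f g h).map_add
  map_rsmul := (foldLin f g h).map_smul
  map_mem {n x} hx := by
    refine grading_induction (φ := φ) hx (by simp) ?_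
      (fun x y hx hy => by rw [map_add]; exact add_mem hx hy)
      (fun r x hx => by rw [map_smul]; exact Submodule.smul_mem _ r hx)
    rintro i j rfl b hb b' hb'
    exact C.mul_mem (f.map_mem hb) (g.map_mem hb')
  comm_d x := by
    change foldLin f g h (diff φ x) = C.dLin (foldLin f g h x)
    induction x using tens_induction with
    | zero => simp
    | add x y hx hy => simp only [map_add, hx, hy]
    | mk i j b hb b' hb' =>
      rw [diff_mk φ hb, map_add, map_zsmul]
      simp only [foldLin_mk, C.dLin_apply, C.leibniz _ _ (f.map_mem hb), f.comm_d, g.comm_d]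

end SelfTensor

namespace EnvelopingAlg

variable {φ : DGAlgHom A B} {E : DGAlgebra R} (he : EnvelopingAlg φ E)

/-- The comparison `E → B ⊗_A B`. -/
theorem exists_toSelfTensor : ∃ Ψ : DGAlgHom E (SelfTensor.dgAlgebra φ),
    (∀ b, Ψ.toFun (he.l.toFun b) = (SelfTensor.inl φ).toFun b) ∧
      ∀ b, Ψ.toFun (he.r.toFun b) = (SelfTensor.inr φ).toFun b := by
  obtain ⟨Ψ, h₁, h₂, -⟩ := he.univ _ (SelfTensor.inl φ) (SelfTensor.inr φ)
    (SelfTensor.mk_map_left φ)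
  exact ⟨Ψ, h₁, h₂⟩

/-- The comparison `E → B ⊗_A B`. -/
def toSelfTensor : E.carrier →ₗ[R] SelfTensor.Tens φ := he.exists_toSelfTensor.choose.lin

theorem toSelfTensor_mul (b b' : B.carrier) :
    he.toSelfTensor (he.l.toFun b * he.r.toFun b') = SelfTensor.mk φ b b' := by
  obtain ⟨h₁, h₂⟩ := he.exists_toSelfTensor.choose_spec
  rw [← SelfTensor.inl_mul_inr, ← h₁, ← h₂]
  exact DGAlgHom.map_mul _ _ _

theorem toSelfTensor_mem {n : ℤ} {x : E.carrier} (hx : x ∈ E.grading n) :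
    he.toSelfTensor x ∈ SelfTensor.grading φ n :=
  he.exists_toSelfTensor.choose.map_mem hx

theorem foldLin_toSelfTensor (x : E.carrier) :
    SelfTensor.foldLin he.l he.r he.compat (he.toSelfTensor x) = x := by
  obtain ⟨h₁, h₂⟩ := he.exists_toSelfTensor.choose_spec
  obtain ⟨k, -, -, hk⟩ := he.univ E he.l he.r he.compat
  let Φ := SelfTensor.fold he.l he.r he.compat
  let Ψ := he.exists_toSelfTensor.choose
  refine (hk ⟨fun x => Φ.toFun (Ψ.toFun x), ?_, ?_, ?_, ?_, ?_, ?_⟩ ⟨?_, ?_⟩ x).trans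
    (hk ⟨id, rfl, fun _ _ => rfl, fun _ _ => rfl, fun _ _ => rfl, id, fun _ => rfl⟩
      ⟨fun _ => rfl, fun _ => rfl⟩ x).symm
  · rw [Ψ.map_one, Φ.map_one]
  · intro x y; rw [Ψ.map_mul, Φ.map_mul]
  · intro x y; rw [Ψ.map_add, Φ.map_add]
  · intro r x; rw [Ψ.map_rsmul, Φ.map_rsmul]
  · exact fun hx => Φ.map_mem (Ψ.map_mem hx)
  · intro x; rw [Ψ.comm_d, Φ.comm_d]
  · intro b
    change Φ.toFun (he.exists_toSelfTensor.choose.toFun _) = _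
    rw [h₁]
    exact (SelfTensor.foldLin_mk he.l he.r he.compat b 1).trans (by rw [he.r.map_one, mul_one])
  · intro b
    change Φ.toFun (he.exists_toSelfTensor.choose.toFun _) = _
    rw [h₂]
    exact (SelfTensor.foldLin_mk he.l he.r he.compat 1 b).trans (by rw [he.l.map_one, one_mul])

@[elab_as_elim]
theorem grading_induction {n : ℤ} {p : E.carrier → Prop} {x : E.carrier} (hx : x ∈ E.grading n)
    (zero : p 0)
    (mul : ∀ i j, i + j = n → ∀ b ∈ B.grading i, ∀ b' ∈ B.grading j,
      p (he.l.toFun b * he.r.toFun b'))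
    (add : ∀ x y, p x → p y → p (x + y)) (smul : ∀ (r : R) x, p x → p (r • x)) : p x := by
  rw [← he.foldLin_toSelfTensor x]
  refine SelfTensor.grading_induction (he.toSelfTensor_mem hx) ?_ ?_ ?_ ?_
  · rwa [map_zero]
  · exact mul
  · intro x y hx hy; rw [map_add]; exact add _ _ hx hy
  · intro r x hx; rw [map_smul]; exact smul _ _ hx

theorem induction {p : E.carrier → Prop} (zero : p 0)
    (mul : ∀ i j, ∀ b ∈ B.grading i, ∀ b' ∈ B.grading j, p (he.l.toFun b * he.r.toFun b'))
    (add : ∀ x y, p x → p y → p (x + y)) (x : E.carrier) : p x := by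
  rw [← he.foldLin_toSelfTensor x]
  induction he.toSelfTensor x using SelfTensor.tens_induction with
  | zero => rwa [map_zero]
  | mk i j b hb b' hb' => exact mul i j b hb b' hb'
  | add x y hx hy => rw [map_add]; exact add _ _ hx hy

/-- Linear maps out of the enveloping algebra from balanced bilinear maps. -/
def lift {V : Type*} [AddCommGroup V] [Module R V] (β : B.carrier →ₗ[R] B.carrier →ₗ[R] V)
    (hβ : ∀ i j k, ∀ b ∈ B.grading i, ∀ a ∈ A.grading j, ∀ b' ∈ B.grading k,
      β (b * φ.toFun a) b' = β b (φ.toFun a * b')) : E.carrier →ₗ[R] V :=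
  SelfTensor.lift φ β hβ ∘ₗ he.toSelfTensor

theorem lift_mul {V : Type*} [AddCommGroup V] [Module R V]
    (β : B.carrier →ₗ[R] B.carrier →ₗ[R] V)
    (hβ : ∀ i j k, ∀ b ∈ B.grading i, ∀ a ∈ A.grading j, ∀ b' ∈ B.grading k,
      β (b * φ.toFun a) b' = β b (φ.toFun a * b')) (b b' : B.carrier) :
    he.lift β hβ (he.l.toFun b * he.r.toFun b') = β b b' := by
  rw [lift, LinearMap.comp_apply, toSelfTensor_mul, SelfTensor.lift_mk]

end EnvelopingAlg
end

noncomputable section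

variable {R : Type} [CommRing R] {A B : DGAlgebra R}

namespace InducedModuleSpec

variable {φ : DGAlgHom A B} {E : DGAlgebra R} {N T : DGModule R B}
  (h : InducedModuleSpec φ N T) (he : EnvelopingAlg φ E)

/-- The identification `n ⊗ (b ⊗ b') ↦ nb ⊗ b'` of `N ⊗_B B^e` with the induced module. -/
def tensor (n : N.carrier) : E.carrier →ₗ[R] T.carrier :=
  he.lift (T.act ∘ₗ h.unit.lin ∘ₗ N.act n) (by
    intro i j k b hb a ha b' hb'
    change T.smul (h.unit.toFun (N.smul n (b * φ.toFun a))) b' =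
      T.smul (h.unit.toFun (N.smul n b)) (φ.toFun a * b')
    rw [← N.smul_mul, h.unit.map_smul, T.smul_mul])

theorem tensor_mul (n : N.carrier) (b b' : B.carrier) :
    h.tensor he n (he.l.toFun b * he.r.toFun b') = T.smul (h.unit.toFun (N.smul n b)) b' :=
  he.lift_mul _ _ b b'

theorem tensor_l (n : N.carrier) (b : B.carrier) :
    h.tensor he n (he.l.toFun b) = h.unit.toFun (N.smul n b) := by
  have := h.tensor_mul he n b 1
  rwa [he.r.map_one, mul_one, T.smul_one] at this

theorem tensor_r (n : N.carrier) (b : B.carrier) :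
    h.tensor he n (he.r.toFun b) = T.smul (h.unit.toFun n) b := by
  have := h.tensor_mul he n 1 b
  rwa [he.l.map_one, one_mul, N.smul_one] at this

theorem tensor_add_left (n n' : N.carrier) (x : E.carrier) :
    h.tensor he (n + n') x = h.tensor he n x + h.tensor he n' x := by
  induction x using he.induction with
  | zero => simp
  | add x y hx hy => rw [map_add, map_add, map_add, hx, hy]; abel
  | mul i j b hb b' hb' => simp only [tensor_mul, N.add_smul, h.unit.map_add, T.add_smul]

theorem tensor_rsmul_left (r : R) (n : N.carrier) (x : E.carrier) :
    h.tensor he (r • n) x = r • h.tensor he n x := by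
  induction x using he.induction with
  | zero => simp
  | add x y hx hy => rw [map_add, map_add, hx, hy, smul_add]
  | mul i j b hb b' hb' => simp only [tensor_mul, N.rsmul_smul, h.unit.map_rsmul, T.rsmul_smul]

theorem tensor_balanced (n : N.carrier) (b : B.carrier) (x : E.carrier) :
    h.tensor he (N.smul n b) x = h.tensor he n (he.l.toFun b * x) := by
  induction x using he.induction with
  | zero => simp
  | add x y hx hy => rw [mul_add, map_add, map_add, hx, hy]
  | mul i j c hc c' hc' => rw [← mul_assoc, ← he.l.map_mul, tensor_mul, tensor_mul, N.smul_mul]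

theorem tensor_act (n : N.carrier) (b : B.carrier) (x : E.carrier) :
    h.tensor he n (x * he.r.toFun b) = T.smul (h.tensor he n x) b := by
  induction x using he.induction with
  | zero => simp [T.zero_smul]
  | add x y hx hy => rw [add_mul, map_add, map_add, hx, hy, T.add_smul]
  | mul i j c hc c' hc' => rw [mul_assoc, ← he.r.map_mul, tensor_mul, tensor_mul, T.smul_mul]

theorem tensor_mem {i j : ℤ} {n : N.carrier} {x : E.carrier} (hn : n ∈ N.grading i)
    (hx : x ∈ E.grading j) : h.tensor he n x ∈ T.grading (i + j) := by
  refine he.grading_induction hx (by simp) ?_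
    (fun x y hx hy => by rw [map_add]; exact add_mem hx hy)
    (fun r x hx => by rw [map_smul]; exact Submodule.smul_mem _ r hx)
  rintro k l rfl b hb b' hb'
  rw [tensor_mul, ← add_assoc]
  exact T.smul_mem (h.unit.map_mem (N.smul_mem hn hb)) hb'

theorem d_tensor {i : ℤ} {n : N.carrier} (hn : n ∈ N.grading i) (x : E.carrier) :
    T.d (h.tensor he n x) = h.tensor he (N.d n) x + ksign i • h.tensor he n (E.d x) := by
  induction x using he.induction with
  | zero => simp [T.d_zero, E.d_zero]
  | add x y hx hy => simp only [map_add, T.d_add, E.d_add, hx, hy, smul_add]; abel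
  | mul j k b hb b' hb' =>
    rw [E.leibniz _ _ (he.l.map_mem hb), ← he.l.comm_d, ← he.r.comm_d, map_add, map_zsmul,
      tensor_mul, tensor_mul, tensor_mul, tensor_mul,
      T.leibniz _ _ (h.unit.map_mem (N.smul_mem hn hb)), ← h.unit.comm_d, N.leibniz _ _ hn,
      h.unit.map_add, T.add_smul, ksign_add]
    have : h.unit.toFun (ksign i • N.smul n (B.d b)) =
      ksign i • h.unit.toFun (N.smul n (B.d b)) := map_zsmul h.unit.lin _ _
    rw [this, T.zsmul_smul, smul_add, mul_smul, add_assoc]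

variable {πB : DGAlgHom E B} (hl : ∀ b, πB.toFun (he.l.toFun b) = b)
  (hr : ∀ b, πB.toFun (he.r.toFun b) = b) {πN : DGHom T N}
  (hπ : ∀ x, πN.toFun (h.unit.toFun x) = x)

include hl hr hπ in
theorem proj_tensor (n : N.carrier) (x : E.carrier) :
    πN.toFun (h.tensor he n x) = N.smul n (πB.toFun x) := by
  change πN.lin _ = _
  induction x using he.induction with
  | zero => simp [πB.map_zero, N.smul_zero]
  | add x y hx hy => rw [map_add, map_add, hx, hy, πB.map_add, N.smul_add]
  | mul i j b hb b' hb' =>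
    rw [tensor_mul]
    refine (πN.map_smul _ _).trans ?_
    rw [hπ, πB.map_mul, hl, hr, N.smul_mul]

end InducedModuleSpec

namespace DGHom

variable {M N : DGModule R B} (f : DGHom M N)

theorem lin_apply (x : M.carrier) : f.lin x = f.toFun x := rfl

theorem map_homogComponent (n : ℤ) (x : M.carrier) :
    f.lin (homogComponent M.grading n x) = homogComponent N.grading n (f.lin x) := by
  induction x using M.homogeneous_induction with
  | zero => simp
  | add x y hx hy => simp only [_root_.map_add, hx, hy]
  | homog i x hx =>
    have hfx : f.lin x ∈ N.grading i := f.map_mem hx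
    by_cases h : i = n
    · subst h
      rw [homogComponent_same _ hx, homogComponent_same _ hfx]
    · rw [homogComponent_ne _ hx h, homogComponent_ne _ hfx h, map_zero]

/-- The kernel of a homomorphism of DG modules. -/
def ker : DGModule R B where
  carrier := LinearMap.ker f.lin
  grading n := (M.grading n).comap (LinearMap.ker f.lin).subtype
  indep := by
    refine disjoint_iSup_of_projections _ (fun n => (homogComponent M.grading n).restrict ?_)
      (fun n x hx => ?_) (fun n j hj x hx => ?_)
    · intro x hx
      rw [LinearMap.mem_ker] at hx ⊢
      rw [map_homogComponent, hx, map_zero]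
    · exact Subtype.ext (homogComponent_same _ hx)
    · exact Subtype.ext (homogComponent_ne _ hx hj)
  spanning := by
    rw [eq_top_iff]
    rintro ⟨x, hx⟩ -
    obtain ⟨s, hs⟩ := eq_sum_homogComponent M.grading x
    have hk (i : ℤ) : homogComponent M.grading i x ∈ LinearMap.ker f.lin := by
      rw [LinearMap.mem_ker] at hx ⊢
      rw [map_homogComponent, hx, map_zero]
    have : (⟨x, hx⟩ : LinearMap.ker f.lin) = ∑ i ∈ s, ⟨homogComponent M.grading i x, hk i⟩ :=
      Subtype.ext (by simp [hs])
    rw [this]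
    exact Submodule.sum_mem _ fun i _ =>
      Submodule.mem_iSup_of_mem i (homogComponent_mem M.grading i x)
  smul x b := ⟨M.smul x.1 b, by
    rw [LinearMap.mem_ker, lin_apply, f.map_smul, ← lin_apply, LinearMap.mem_ker.1 x.2,
      N.zero_smul]⟩
  smul_add _ _ _ := Subtype.ext (M.smul_add _ _ _)
  add_smul _ _ _ := Subtype.ext (M.add_smul _ _ _)
  smul_rsmul _ _ _ := Subtype.ext (M.smul_rsmul _ _ _)
  rsmul_smul _ _ _ := Subtype.ext (M.rsmul_smul _ _ _)
  smul_one _ := Subtype.ext (M.smul_one _)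
  smul_mul _ _ _ := Subtype.ext (M.smul_mul _ _ _)
  smul_mem hm ha := M.smul_mem hm ha
  d x := ⟨M.d x.1, by
    rw [LinearMap.mem_ker, lin_apply, f.comm_d, ← lin_apply, LinearMap.mem_ker.1 x.2, N.d_zero]⟩
  d_add _ _ := Subtype.ext (M.d_add _ _)
  d_rsmul _ _ := Subtype.ext (M.d_rsmul _ _)
  d_mem hm := M.d_mem hm
  d_sq _ := Subtype.ext (M.d_sq _)
  leibniz _ _ hm := Subtype.ext (M.leibniz _ _ hm)

end DGHom
end

noncomputable section

variable {R : Type} [CommRing R] {A B : DGAlgebra R}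

namespace TensorPairing

variable {φ : DGAlgHom A B} {E : DGAlgebra R} {he : EnvelopingAlg φ E} {πB : DGAlgHom E B}
  {N W : DGModule R B} (γ : TensorPairing φ he (diagIdeal he πB) ∅ N W)

theorem pair_zero_right (n : N.carrier) : γ.pair n 0 = 0 := by
  have := γ.rsmul_right 0 n 0 πB.map_zero
  rwa [zero_smul, zero_smul] at this

theorem pair_zero_left {x : E.carrier} (hx : x ∈ diagIdeal he πB) : γ.pair 0 x = 0 := by
  have := γ.rsmul_left 0 0 x hx
  rwa [zero_smul, zero_smul] at this

variable (hl : ∀ b, πB.toFun (he.l.toFun b) = b) (hr : ∀ b, πB.toFun (he.r.toFun b) = b)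

include hl hr in
theorem r_sub_l_mem (b : B.carrier) : he.r.toFun b - he.l.toFun b ∈ diagIdeal he πB := by
  change πB.toFun _ = 0
  rw [πB.map_sub, hl, hr, sub_self]

include hl in
theorem sub_l_mem (x : E.carrier) : x - he.l.toFun (πB.toFun x) ∈ diagIdeal he πB := by
  change πB.toFun _ = 0
  rw [πB.map_sub, hl, sub_self]

/-- The DG module `N ⊕ W` whose action is twisted by the pairing with `1 ⊗ b - b ⊗ 1`. -/
def twist : DGModule R B where
  carrier := N.carrier × W.carrier
  grading n := (N.grading n).prod (W.grading n)
  indep := by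
    refine disjoint_iSup_of_projections _
      (fun n => (homogComponent N.grading n).prodMap (homogComponent W.grading n))
      (fun n x hx => ?_) (fun n j hj x hx => ?_)
    · exact Prod.ext (homogComponent_same _ hx.1) (homogComponent_same _ hx.2)
    · exact Prod.ext (homogComponent_ne _ hx.1 hj) (homogComponent_ne _ hx.2 hj)
  spanning := by
    rw [eq_top_iff]
    rintro ⟨n, w⟩ -
    rw [← Prod.fst_add_snd (n, w)]
    refine add_mem ?_ ?_
    · induction n using N.homogeneous_induction with
      | zero => exact zero_mem _
      | add x y hx hy =>
        have : (x + y, (0 : W.carrier)) = (x, 0) + (y, 0) := Prod.ext rfl (add_zero 0).symm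
        exact this ▸ add_mem hx hy
      | homog i x hx => exact Submodule.mem_iSup_of_mem i ⟨hx, zero_mem _⟩
    · induction w using W.homogeneous_induction with
      | zero => exact zero_mem _
      | add x y hx hy =>
        have : ((0 : N.carrier), x + y) = (0, x) + (0, y) := Prod.ext (add_zero 0).symm rfl
        exact this ▸ add_mem hx hy
      | homog i x hx => exact Submodule.mem_iSup_of_mem i ⟨zero_mem _, hx⟩
  smul x b := (N.smul x.1 b, W.smul x.2 b + γ.pair x.1 (he.r.toFun b - he.l.toFun b))
  smul_add x a b := by
    refine Prod.ext (N.smul_add _ _ _) ?_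
    have : he.r.toFun (a + b) - he.l.toFun (a + b) =
        (he.r.toFun a - he.l.toFun a) + (he.r.toFun b - he.l.toFun b) := by
      rw [he.r.map_add, he.l.map_add]; abel
    change W.smul x.2 (a + b) + γ.pair _ _ = (_ + _) + (_ + _)
    rw [this, γ.add_right _ _ _ (r_sub_l_mem hl hr a) (r_sub_l_mem hl hr b), W.smul_add]
    abel
  add_smul x y b := by
    refine Prod.ext (N.add_smul _ _ _) ?_
    change W.smul (x.2 + y.2) b + γ.pair (x.1 + y.1) _ = (_ + _) + (_ + _)
    rw [γ.add_left _ _ _ (r_sub_l_mem hl hr b), W.add_smul]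
    abel
  smul_rsmul r x b := by
    refine Prod.ext (N.smul_rsmul _ _ _) ?_
    change W.smul x.2 (r • b) + γ.pair _ _ = r • (_ + _)
    rw [he.r.map_rsmul, he.l.map_rsmul, ← smul_sub, γ.rsmul_right _ _ _ (r_sub_l_mem hl hr b),
      W.smul_rsmul, smul_add]
  rsmul_smul r x b := by
    refine Prod.ext (N.rsmul_smul _ _ _) ?_
    change W.smul (r • x.2) b + γ.pair (r • x.1) _ = r • (_ + _)
    rw [γ.rsmul_left _ _ _ (r_sub_l_mem hl hr b), W.rsmul_smul, smul_add]
  smul_one x := by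
    refine Prod.ext (N.smul_one _) ?_
    change W.smul x.2 1 + γ.pair _ _ = x.2
    rw [he.r.map_one, he.l.map_one, sub_self, pair_zero_right, W.smul_one, add_zero]
  smul_mul x a b := by
    refine Prod.ext (N.smul_mul _ _ _) ?_
    have h₁ : he.r.toFun (a * b) - he.l.toFun (a * b) =
        (he.r.toFun a - he.l.toFun a) * he.r.toFun b +
          he.l.toFun a * (he.r.toFun b - he.l.toFun b) := by
      rw [he.r.map_mul, he.l.map_mul, sub_mul, mul_sub]; abel
    have h₂ : (he.r.toFun a - he.l.toFun a) * he.r.toFun b ∈ diagIdeal he πB := by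
      have := r_sub_l_mem hl hr a
      change πB.toFun _ = 0 at this ⊢
      rw [πB.map_mul, this, zero_mul]
    have h₃ : he.l.toFun a * (he.r.toFun b - he.l.toFun b) ∈ diagIdeal he πB := by
      have := r_sub_l_mem hl hr b
      change πB.toFun _ = 0 at this ⊢
      rw [πB.map_mul, this, mul_zero]
    change W.smul (W.smul x.2 a + γ.pair x.1 _) b + γ.pair (N.smul x.1 a) _ =
      W.smul x.2 (a * b) + γ.pair x.1 _
    rw [h₁, γ.add_right _ _ _ h₂ h₃, γ.act_right _ _ _ (r_sub_l_mem hl hr a),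
      γ.balanced _ _ _ (r_sub_l_mem hl hr b), W.add_smul, W.smul_mul, add_assoc]
  smul_mem hm ha := ⟨N.smul_mem hm.1 ha, add_mem (W.smul_mem hm.2 ha)
    (γ.grade _ _ hm.1 (r_sub_l_mem hl hr _) (sub_mem (he.r.map_mem ha) (he.l.map_mem ha)))⟩
  d x := (N.d x.1, W.d x.2)
  d_add x y := Prod.ext (N.d_add _ _) (W.d_add _ _)
  d_rsmul x y := Prod.ext (N.d_rsmul _ _) (W.d_rsmul _ _)
  d_mem hm := ⟨N.d_mem hm.1, W.d_mem hm.2⟩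
  d_sq x := Prod.ext (N.d_sq _) (W.d_sq _)
  leibniz {i} x b hx := by
    refine Prod.ext (N.leibniz _ _ hx.1) ?_
    change W.d (W.smul x.2 b + γ.pair x.1 _) = (W.smul (W.d x.2) b + γ.pair (N.d x.1) _) +
      ksign i • (W.smul x.2 (B.d b) + γ.pair x.1 _)
    rw [W.d_add, W.leibniz _ _ hx.2, γ.chain _ _ hx.1 (r_sub_l_mem hl hr b), E.d_sub,
      he.r.comm_d, he.l.comm_d, smul_add]
    abel

/-- The map `n ↦ (n, 0)`. -/
def twistUnit : ResHomB φ N (γ.twist hl hr) where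
  toFun n := (n, 0)
  map_add x y := Prod.ext rfl (add_zero 0).symm
  map_rsmul r x := Prod.ext rfl (smul_zero r).symm
  map_mem hx := ⟨hx, zero_mem _⟩
  map_smul x a := by
    refine Prod.ext rfl ?_
    change 0 = W.smul 0 _ + γ.pair x _
    rw [he.compat, sub_self, pair_zero_right, W.zero_smul, add_zero]
  comm_d x := Prod.ext rfl W.d_zero.symm

end TensorPairing

namespace InducedModuleSpec

variable {φ : DGAlgHom A B} {E : DGAlgebra R} {N T : DGModule R B}
  (h : InducedModuleSpec φ N T) (he : EnvelopingAlg φ E)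
  {πB : DGAlgHom E B} (hl : ∀ b, πB.toFun (he.l.toFun b) = b)
  (hr : ∀ b, πB.toFun (he.r.toFun b) = b) {πN : DGHom T N}
  (hπ : ∀ x, πN.toFun (h.unit.toFun x) = x)

include h in
theorem dgHom_ext {W : DGModule R B} {f g : DGHom T W}
    (hfg : ∀ x, f.toFun (h.unit.toFun x) = g.toFun (h.unit.toFun x)) (t : T.carrier) :
    f.toFun t = g.toFun t := by
  obtain ⟨k, -, hk⟩ := h.univ W
    ⟨fun x => g.toFun (h.unit.toFun x), fun x y => by rw [h.unit.map_add, g.map_add],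
      fun r x => by rw [h.unit.map_rsmul, g.map_rsmul], fun hx => g.map_mem (h.unit.map_mem hx),
      fun x a => by rw [h.unit.map_smul, g.map_smul], fun x => by rw [h.unit.comm_d, g.comm_d]⟩
  rw [hk f hfg, hk g fun _ => rfl]

/-- The projection `t ↦ t - π(t) ⊗ 1` onto the kernel of `π`. -/
def toKer : T.carrier →ₗ[R] LinearMap.ker πN.lin :=
  (LinearMap.id - h.unit.lin ∘ₗ πN.lin).codRestrict _ fun t => by
    rw [LinearMap.mem_ker, LinearMap.sub_apply, map_sub, sub_eq_zero]
    exact (hπ _).symm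

theorem toKer_coe (t : T.carrier) :
    (h.toKer hπ t : T.carrier) = t - h.unit.toFun (πN.toFun t) := rfl

theorem toKer_of_mem {t : T.carrier} (ht : πN.toFun t = 0) :
    (h.toKer hπ t : T.carrier) = t := by
  rw [toKer_coe, ht]
  exact (congrArg _ (map_zero h.unit.lin)).trans (sub_zero t)

theorem toKer_unit (n : N.carrier) : h.toKer hπ (h.unit.toFun n) = 0 :=
  Subtype.ext (by rw [toKer_coe, hπ, sub_self]; rfl)

include hl hr hπ in
theorem toKer_tensor (n : N.carrier) {x : E.carrier} (hx : x ∈ diagIdeal he πB) :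
    (h.toKer hπ (h.tensor he n x) : T.carrier) = h.tensor he n x := by
  refine h.toKer_of_mem hπ ?_
  change πB.toFun x = 0 at hx
  rw [h.proj_tensor he hl hr hπ, hx, N.smul_zero]

theorem toKer_smul (t : T.carrier) (b : B.carrier) :
    (h.toKer hπ (T.smul t b) : T.carrier) = T.smul (h.toKer hπ t) b +
      h.toKer hπ (h.tensor he (πN.toFun t) (he.r.toFun b - he.l.toFun b)) := by
  have : h.tensor he (πN.toFun t) (he.r.toFun b - he.l.toFun b) =
      T.smul (h.unit.toFun (πN.toFun t)) b - h.unit.toFun (N.smul (πN.toFun t) b) := by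
    rw [map_sub, tensor_r, tensor_l]
  rw [this, map_sub, toKer_unit, sub_zero]
  rw [toKer_coe, toKer_coe, toKer_coe, πN.map_smul, πN.map_smul, hπ, T.sub_smul]
  abel

/-- The pairing `N × J → ker π_N`. -/
def kerPairing : TensorPairing φ he (diagIdeal he πB) ∅ N πN.ker where
  pair n x := h.toKer hπ (h.tensor he n x)
  add_left n n' x _ := by rw [tensor_add_left]; exact map_add _ _ _
  add_right n x y _ _ := by rw [map_add]; exact map_add _ _ _
  rsmul_left r n x _ := by rw [tensor_rsmul_left]; exact map_smul _ _ _
  rsmul_right r n x _ := by rw [map_smul]; exact map_smul _ _ _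
  balanced n b x _ := by rw [tensor_balanced]
  act_right n b x hx := by
    have hx' : x * he.r.toFun b ∈ diagIdeal he πB := by
      change πB.toFun _ = 0 at hx ⊢
      rw [πB.map_mul, hx, zero_mul]
    refine Subtype.ext ?_
    rw [h.toKer_tensor he hl hr hπ n hx', tensor_act]
    exact congrArg (T.smul · b) (h.toKer_tensor he hl hr hπ n hx).symm
  grade {i j} n x hn hx hxj := by
    change (h.toKer hπ (h.tensor he n x) : T.carrier) ∈ T.grading (i + j)
    rw [h.toKer_tensor he hl hr hπ n hx]
    exact h.tensor_mem he hn hxj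
  chain {i} n x hn hx := by
    have hx' : E.d x ∈ diagIdeal he πB := by
      change πB.toFun _ = 0 at hx ⊢
      rw [πB.comm_d, hx, B.d_zero]
    refine Subtype.ext ?_
    change T.d (h.toKer hπ (h.tensor he n x) : T.carrier) =
      (h.toKer hπ (h.tensor he (N.d n) x) : T.carrier) +
        ksign i • (h.toKer hπ (h.tensor he n (E.d x)) : T.carrier)
    rw [h.toKer_tensor he hl hr hπ n hx, h.toKer_tensor he hl hr hπ _ hx,
      h.toKer_tensor he hl hr hπ _ hx', h.d_tensor he hn]
  kill _ _ hx := hx.elim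

end InducedModuleSpec
end

noncomputable section

variable {R : Type} [CommRing R] {A B : DGAlgebra R}

namespace InducedModuleSpec

variable {φ : DGAlgHom A B} {E : DGAlgebra R} {N T : DGModule R B}
  (h : InducedModuleSpec φ N T) (he : EnvelopingAlg φ E)
  {πB : DGAlgHom E B} (hl : ∀ b, πB.toFun (he.l.toFun b) = b)
  (hr : ∀ b, πB.toFun (he.r.toFun b) = b) {πN : DGHom T N}
  (hπ : ∀ x, πN.toFun (h.unit.toFun x) = x)

section Universal

variable {W : DGModule R B} (γ : TensorPairing φ he (diagIdeal he πB) ∅ N W)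

include h hl hr in
theorem exists_toTwist : ∃ G : DGHom T (γ.twist hl hr),
    ∀ n, G.toFun (h.unit.toFun n) = ((n, 0) : N.carrier × W.carrier) := by
  obtain ⟨G, hG, -⟩ := h.univ _ (γ.twistUnit hl hr)
  exact ⟨G, hG⟩

variable {he hl hr γ} {G : DGHom T (γ.twist hl hr)}
  (hG : ∀ n, G.toFun (h.unit.toFun n) = ((n, 0) : N.carrier × W.carrier))

include hπ hG in
theorem toTwist_fst (t : T.carrier) : (G.toFun t).1 = πN.toFun t := by
  let G₁ : DGHom T N :=
    { toFun := fun t => (G.toFun t).1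
      map_add := fun x y => congrArg Prod.fst (G.map_add x y)
      map_rsmul := fun r x => congrArg Prod.fst (G.map_rsmul r x)
      map_smul := fun x b => congrArg Prod.fst (G.map_smul x b)
      map_mem := fun hx => (G.map_mem hx).1
      comm_d := fun x => congrArg Prod.fst (G.comm_d x) }
  refine h.dgHom_ext (f := G₁) (g := πN) (fun x => ?_) t
  rw [hπ]
  exact congrArg Prod.fst (hG x)

include hG in
theorem toTwist_tensor_snd (n : N.carrier) (x : E.carrier) :
    (G.toFun (h.tensor he n x)).2 = γ.pair n (x - he.l.toFun (πB.toFun x)) := by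
  induction x using he.induction with
  | zero =>
    rw [map_zero, πB.map_zero, he.l.map_zero, sub_zero, γ.pair_zero_right]
    exact congrArg Prod.snd (map_zero G.lin)
  | add x y hx hy =>
    have : x + y - he.l.toFun (πB.toFun (x + y)) =
        (x - he.l.toFun (πB.toFun x)) + (y - he.l.toFun (πB.toFun y)) := by
      rw [πB.map_add, he.l.map_add]; abel
    rw [this, γ.add_right _ _ _ (TensorPairing.sub_l_mem hl x) (TensorPairing.sub_l_mem hl y),
      ← hx, ← hy, map_add]
    exact congrArg Prod.snd (G.map_add _ _)
  | mul i j b hb b' hb' =>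
    rw [tensor_mul]
    refine (congrArg Prod.snd (G.map_smul _ b')).trans ?_
    rw [hG]
    change W.smul 0 b' + γ.pair (N.smul n b) _ = _
    rw [W.zero_smul, zero_add, γ.balanced _ _ _ (TensorPairing.r_sub_l_mem hl hr b'), mul_sub,
      πB.map_mul, hl, hr, he.l.map_mul]

/-- The homomorphism out of `ker π_N` induced by a pairing. -/
def kerDesc : DGHom πN.ker W where
  toFun x := (G.toFun x.1).2
  map_add x y := congrArg Prod.snd (G.map_add x.1 y.1)
  map_rsmul r x := congrArg Prod.snd (G.map_rsmul r x.1)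
  map_smul x b := by
    refine (congrArg Prod.snd (G.map_smul x.1 b)).trans ?_
    change W.smul _ b + γ.pair (G.toFun x.1).1 _ = _
    have hx : πN.toFun x.1 = 0 := x.2
    rw [h.toTwist_fst hπ hG, hx, γ.pair_zero_left (TensorPairing.r_sub_l_mem hl hr b), add_zero]
  map_mem hx := (G.map_mem hx).2
  comm_d x := congrArg Prod.snd (G.comm_d x.1)

theorem kerDesc_pair (n : N.carrier) {x : E.carrier} (hx : x ∈ diagIdeal he πB) :
    (h.kerDesc hπ hG).toFun ((h.kerPairing he hl hr hπ).pair n x) = γ.pair n x := by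
  have hx' : πB.toFun x = 0 := hx
  change (G.toFun (h.toKer hπ (h.tensor he n x) : T.carrier)).2 = _
  rw [h.toKer_tensor he hl hr hπ n hx, h.toTwist_tensor_snd hG, hx', he.l.map_zero, sub_zero]

theorem kerDesc_unique (g : DGHom πN.ker W)
    (hg : ∀ n x, x ∈ diagIdeal he πB →
      g.toFun ((h.kerPairing he hl hr hπ).pair n x) = γ.pair n x) (p : πN.ker.carrier) :
    g.toFun p = (h.kerDesc hπ hG).toFun p := by
  let G' : DGHom T (γ.twist hl hr) :=
    { toFun := fun t => (πN.toFun t, g.toFun (h.toKer hπ t))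
      map_add := fun x y => Prod.ext (πN.map_add x y)
        ((congrArg g.toFun (map_add (h.toKer hπ) x y)).trans (g.map_add _ _))
      map_rsmul := fun r x => Prod.ext (πN.map_rsmul r x)
        ((congrArg g.toFun (map_smul (h.toKer hπ) r x)).trans (g.map_rsmul _ _))
      map_smul := fun x b => by
        refine Prod.ext (πN.map_smul x b) ?_
        refine (congrArg g.toFun (Subtype.ext (h.toKer_smul he hπ x b))).trans
          ((g.map_add (πN.ker.smul (h.toKer hπ x) b) (h.toKer hπ _)).trans ?_)
        exact congrArg₂ (· + ·) (g.map_smul _ b) (hg _ _ (TensorPairing.r_sub_l_mem hl hr b))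
      map_mem := fun hx => ⟨πN.map_mem hx,
        g.map_mem (sub_mem hx (h.unit.map_mem (πN.map_mem hx)))⟩
      comm_d := fun x => by
        refine Prod.ext (πN.comm_d x) ?_
        refine (congrArg g.toFun (Subtype.ext ?_)).trans (g.comm_d _)
        change T.d x - h.unit.toFun (πN.toFun (T.d x)) = T.d (x - h.unit.toFun (πN.toFun x))
        rw [T.d_sub, πN.comm_d, h.unit.comm_d] }
  have hG' : ∀ n, G'.toFun (h.unit.toFun n) = G.toFun (h.unit.toFun n) := fun n => by
    rw [hG]
    refine Prod.ext (hπ n) ?_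
    exact (congrArg g.toFun (h.toKer_unit hπ n)).trans (map_zero g.lin)
  have key := congrArg Prod.snd (h.dgHom_ext hG' p.1)
  have hp : h.toKer hπ p.1 = p := Subtype.ext (h.toKer_of_mem hπ p.2)
  exact (congrArg g.toFun hp.symm).trans key

end Universal

/-- The kernel of `π_N` is the tensor product of `N` with the diagonal ideal. -/
def kerIsTensor : IsTensorSubquot φ he (diagIdeal he πB) ∅ N πN.ker where
  pairing := h.kerPairing he hl hr hπ
  univ _ γ := by
    obtain ⟨G, hG⟩ := h.exists_toTwist he hl hr γ
    exact ⟨h.kerDesc hπ hG, fun n x hx => h.kerDesc_pair hπ hG n hx,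
      fun g hg p => h.kerDesc_unique hπ hG g hg p⟩

end InducedModuleSpec

namespace SemifreeBasisOn

variable {N : DGModule R B} {κ : Type} {e : κ → N.carrier} (s : SemifreeBasisOn N e)

/-- The coordinates with respect to a semifree basis. -/
def repr : (κ →₀ B.carrier) ≃ₗ[R] N.carrier :=
  LinearEquiv.ofBijective (Finsupp.lsum R fun k => N.act (e k)) s.basis

theorem repr_single (k : κ) (b : B.carrier) : s.repr (Finsupp.single k b) = N.smul (e k) b :=
  Finsupp.sum_single_index (N.smul_zero (e k))

include s in
theorem induction {p : N.carrier → Prop} (zero : p 0)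
    (smul : ∀ k i, ∀ b ∈ B.grading i, p (N.smul (e k) b))
    (add : ∀ x y, p x → p y → p (x + y)) (x : N.carrier) : p x := by
  obtain ⟨c, rfl⟩ := s.repr.surjective x
  induction c using Finsupp.induction_linear with
  | zero => rwa [map_zero]
  | add c c' hc hc' => rw [map_add]; exact add _ _ hc hc'
  | single k b =>
    rw [repr_single]
    induction b using B.homogeneous_induction with
    | zero => rwa [N.smul_zero]
    | add b b' hb hb' => rw [N.smul_add]; exact add _ _ hb hb'
    | homog i b hb => exact smul k i b hb

variable {T : DGModule R B} (t : κ → T.carrier)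

/-- The graded linear map with prescribed values on a semifree basis. -/
def constr : N.carrier →ₗ[R] T.carrier :=
  (Finsupp.lsum R fun k => T.act (t k)) ∘ₗ s.repr.symm.toLinearMap

theorem constr_smul_basis (k : κ) (b : B.carrier) :
    s.constr t (N.smul (e k) b) = T.smul (t k) b := by
  rw [← repr_single, constr, LinearMap.comp_apply, LinearEquiv.coe_coe,
    LinearEquiv.symm_apply_apply]
  exact Finsupp.sum_single_index (T.smul_zero (t k))

theorem constr_smul (n : N.carrier) (b : B.carrier) :
    s.constr t (N.smul n b) = T.smul (s.constr t n) b := by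
  induction n using s.induction with
  | zero => rw [N.zero_smul, map_zero, T.zero_smul]
  | add x y hx hy => rw [N.add_smul, map_add, map_add, hx, hy, T.add_smul]
  | smul k i c hc => rw [N.smul_mul, constr_smul_basis, constr_smul_basis, T.smul_mul]

variable {t} (ht : ∀ k, t k ∈ T.grading (s.deg k))

include ht in
theorem constr_mem {i : ℤ} {n : N.carrier} (hn : n ∈ N.grading i) :
    s.constr t n ∈ T.grading i := by
  have key (n : N.carrier) : s.constr t (homogComponent N.grading i n) =
      homogComponent T.grading i (s.constr t n) := by
    induction n using s.induction with
    | zero => simp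
    | add x y hx hy => simp only [map_add, hx, hy]
    | smul k j b hb =>
      have h₁ := N.smul_mem (s.homog k) hb
      have h₂ := T.smul_mem (ht k) hb
      by_cases h : s.deg k + j = i
      · subst h
        rw [homogComponent_same _ h₁, constr_smul_basis, homogComponent_same _ h₂]
      · rw [homogComponent_ne _ h₁ h, map_zero, constr_smul_basis, homogComponent_ne _ h₂ h]
  rw [← homogComponent_same _ hn, key]
  exact homogComponent_mem _ _ _

variable {π : DGHom T N} (hπ : ∀ k, π.toFun (t k) = e k)

include hπ in
theorem proj_constr (n : N.carrier) : π.toFun (s.constr t n) = n := by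
  change π.lin _ = n
  induction n using s.induction with
  | zero => simp
  | add x y hx hy => simp only [map_add, hx, hy]
  | smul k i b hb =>
    rw [constr_smul_basis]
    exact (π.map_smul _ b).trans (by rw [hπ])

/-- The failure of a graded section of `π` to commute with the differentials. -/
def obstruction : GradedHom N π.ker (-1) where
  toFun n := ⟨T.d (s.constr t n) - s.constr t (N.d n), by
    rw [LinearMap.mem_ker, map_sub, sub_eq_zero]
    refine (π.comm_d _).trans ?_
    rw [s.proj_constr hπ]
    exact (s.proj_constr hπ _).symm⟩
  map_add x y := Subtype.ext (by
    change T.d (s.constr t (x + y)) - s.constr t (N.d (x + y)) =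
      (T.d (s.constr t x) - s.constr t (N.d x)) + (T.d (s.constr t y) - s.constr t (N.d y))
    rw [map_add, N.d_add, T.d_add, map_add]
    abel)
  map_rsmul r x := Subtype.ext (by
    change T.d (s.constr t (r • x)) - s.constr t (N.d (r • x)) =
      r • (T.d (s.constr t x) - s.constr t (N.d x))
    rw [map_smul, N.d_rsmul, T.d_rsmul, map_smul, smul_sub])
  map_smul x b := Subtype.ext (by
    change T.d (s.constr t (N.smul x b)) - s.constr t (N.d (N.smul x b)) =
      T.smul (T.d (s.constr t x) - s.constr t (N.d x)) b
    induction x using N.homogeneous_induction with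
    | zero => simp [N.zero_smul, T.zero_smul, N.d_zero, T.d_zero]
    | add x y hx hy =>
      simp only [map_add, N.d_add, T.d_add, N.add_smul, T.add_smul, T.sub_smul] at hx hy ⊢
      rw [add_sub_add_comm, hx, hy]
      abel
    | homog i x hx =>
      rw [N.leibniz _ _ hx, map_add, map_zsmul, constr_smul, constr_smul, constr_smul,
        T.leibniz _ _ (s.constr_mem ht hx), T.sub_smul]
      abel)
  map_mem hx := sub_mem (T.d_mem (s.constr_mem ht hx)) (s.constr_mem ht (N.d_mem hx))

include s ht hπ in
theorem exists_section (hext : ExtVanish 1 N π.ker) :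
    ∃ ρ : DGHom N T, ∀ y, π.toFun (ρ.toFun y) = y := by
  obtain ⟨k, hk⟩ := hext (s.obstruction ht hπ) fun x => Subtype.ext (by
    change T.d (T.d (s.constr t x) - s.constr t (N.d x)) =
      ksign 1 • (T.d (s.constr t (N.d x)) - s.constr t (N.d (N.d x)))
    rw [N.d_sq, map_zero, sub_zero, T.d_sub, T.d_sq, zero_sub, ksign_one, neg_one_zsmul])
  refine ⟨⟨fun x => s.constr t x - (k.toFun x).1, fun x y => ?_, fun r x => ?_, fun x b => ?_,
    fun {i x} hx => ?_, fun x => ?_⟩, fun y => ?_⟩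
  · rw [map_add, k.map_add]
    change _ - (_ + _) = _
    abel
  · rw [map_smul, k.map_rsmul, smul_sub]
    rfl
  · rw [constr_smul, k.map_smul, T.sub_smul]
    rfl
  · refine sub_mem (s.constr_mem ht hx) ?_
    have : (k.toFun x).1 ∈ T.grading (i + (-1 + 1)) := k.map_mem hx
    rwa [show i + (-1 + 1) = i by ring] at this
  · have h₁ : T.d (s.constr t x) - s.constr t (N.d x) =
        T.d (k.toFun x).1 + ksign 1 • (k.toFun (N.d x)).1 := congrArg Subtype.val (hk x)
    rw [ksign_one, neg_one_zsmul] at h₁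
    rw [T.d_sub, sub_eq_sub_iff_add_eq_add]
    rw [← sub_eq_add_neg, sub_eq_sub_iff_add_eq_add] at h₁
    rw [add_comm, ← h₁, add_comm]
  · change π.lin _ = y
    rw [map_sub, show π.lin (k.toFun y).1 = 0 from (k.toFun y).2, sub_zero]
    exact s.proj_constr hπ y

end SemifreeBasisOn
end

/-- Let `A → B` be a homomorphism of strongly commutative DG
`R`-algebras with `B` free as an underlying graded `A`-module and diagonal ideal
`J = ker(π_B)`. If `N` is a semifree DG `B`-module with `Ext^1_B(N, N ⊗_B J) = 0`,
then `N` is naively liftable to `A`. -/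
theorem naively_liftable_of_ext1_vanish
    {R : Type} [CommRing R] {A B : DGAlgebra R} (φ : DGAlgHom A B)
    (hfree : FreeOverBase φ)
    (E : DGAlgebra R) (he : EnvelopingAlg φ E) (πB : DGAlgHom E B)
    (hl : ∀ b, πB.toFun (he.l.toFun b) = b) (hr : ∀ b, πB.toFun (he.r.toFun b) = b)
    (N : DGModule R B) (hsf : IsSemifree N)
    (hext : ∀ P : DGModule R B,
      IsTensorSubquot φ he (diagIdeal he πB) ∅ N P → ExtVanish 1 N P) :
    NaivelyLiftable φ N := by
  obtain ⟨κ, e, ⟨s⟩⟩ := hsf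
  intro T h πN hπ
  exact s.exists_section (t := fun k => h.unit.toFun (e k)) (fun k => h.unit.map_mem (s.homog k))
    (fun k => hπ (e k)) (hext πN.ker (h.kerIsTensor he hl hr hπ))
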